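/- arXiv:math/0311442 — 2 statements merged into one kernel-verified Lean document; each statement's English description precedes it below -/
import Mathlib

section
/- Let n ≥ 1, 0 ≤ r ≤ n, and let Λ ∈ M_n(k*) be multiplicatively antisymmetric. Let (D, ι) be a division ring of fractions of S_{n,r}^Λ(k). Then the quantum torus O_Λ((k*)^n) is a maximal quantum subtorus of D. -/
universe u

/-- A matrix is multiplicatively antisymmetric if `Λ i i = 1` and `Λ i j * Λ j i = 1`
for all `i, j`. -/
def Matrix.MulAntisymmetric {k : Type u} [Field k] {n : ℕ}
    (Λ : Matrix (Fin n) (Fin n) k) : Prop :=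
  (∀ i, Λ i i = 1) ∧ ∀ i j, Λ i j * Λ j i = 1

inductive QTorusRel (k : Type u) [Field k] {n : ℕ} (Λ : Matrix (Fin n) (Fin n) k) :
    FreeAlgebra k (Fin n ⊕ Fin n) → FreeAlgebra k (Fin n ⊕ Fin n) → Prop
  | comm (i j : Fin n) :
      QTorusRel k Λ (FreeAlgebra.ι k (Sum.inl i) * FreeAlgebra.ι k (Sum.inl j))
        (algebraMap k _ (Λ i j) * (FreeAlgebra.ι k (Sum.inl j) * FreeAlgebra.ι k (Sum.inl i)))
  | mul_inv (i : Fin n) :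
      QTorusRel k Λ (FreeAlgebra.ι k (Sum.inl i) * FreeAlgebra.ι k (Sum.inr i)) 1
  | inv_mul (i : Fin n) :
      QTorusRel k Λ (FreeAlgebra.ι k (Sum.inr i) * FreeAlgebra.ι k (Sum.inl i)) 1

/-- The quantum torus `O_Λ((k*)^n)`. -/
def QuantumTorus (k : Type u) [Field k] {n : ℕ} (Λ : Matrix (Fin n) (Fin n) k) :=
  RingQuot (QTorusRel k Λ)

noncomputable instance (k : Type u) [Field k] {n : ℕ} (Λ : Matrix (Fin n) (Fin n) k) :
    Ring (QuantumTorus k Λ) := by unfold QuantumTorus; infer_instance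

noncomputable instance (k : Type u) [Field k] {n : ℕ} (Λ : Matrix (Fin n) (Fin n) k) :
    Algebra k (QuantumTorus k Λ) := by unfold QuantumTorus; infer_instance

/-- The generator `y_i` of the quantum torus. -/
noncomputable def QuantumTorus.y (k : Type u) [Field k] {n : ℕ}
    (Λ : Matrix (Fin n) (Fin n) k) (i : Fin n) : QuantumTorus k Λ :=
  RingQuot.mkAlgHom k (QTorusRel k Λ) (FreeAlgebra.ι k (Sum.inl i))

/-- The generator `y_i⁻¹` of the quantum torus. -/
noncomputable def QuantumTorus.yinv (k : Type u) [Field k] {n : ℕ}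
    (Λ : Matrix (Fin n) (Fin n) k) (i : Fin n) : QuantumTorus k Λ :=
  RingQuot.mkAlgHom k (QTorusRel k Λ) (FreeAlgebra.ι k (Sum.inr i))


/-- `O_Λ((k*)^n)` is a maximal quantum subtorus of the `k`-algebra `A` if it embeds
into `A` and every quantum torus admitting a homomorphic image in `A` admits a
homomorphic image in `O_Λ((k*)^n)`. -/
def IsMaxQuantumSubtorus (k : Type u) [Field k] {n : ℕ} (Λ : Matrix (Fin n) (Fin n) k)
    (A : Type u) [Ring A] [Algebra k A] : Prop :=
  (∃ f : QuantumTorus k Λ →ₐ[k] A, Function.Injective f) ∧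
  ∀ (m : ℕ), 1 ≤ m → ∀ M : Matrix (Fin m) (Fin m) k, M.MulAntisymmetric →
    Nonempty (QuantumTorus k M →ₐ[k] A) →
    Nonempty (QuantumTorus k M →ₐ[k] QuantumTorus k Λ)

inductive MixedCrossedRel (k : Type u) [Field k] {n : ℕ} (Λ : Matrix (Fin n) (Fin n) k)
    (r : ℕ) (hr : r ≤ n) :
    FreeAlgebra k (Fin n ⊕ Fin r) → FreeAlgebra k (Fin n ⊕ Fin r) → Prop
  | yy (i j : Fin n) :
      MixedCrossedRel k Λ r hr
        (FreeAlgebra.ι k (Sum.inl i) * FreeAlgebra.ι k (Sum.inl j))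
        (algebraMap k _ (Λ i j) * (FreeAlgebra.ι k (Sum.inl j) * FreeAlgebra.ι k (Sum.inl i)))
  | xy_same (i : Fin r) :
      MixedCrossedRel k Λ r hr
        (FreeAlgebra.ι k (Sum.inr i) * FreeAlgebra.ι k (Sum.inl (Fin.castLE hr i)))
        (FreeAlgebra.ι k (Sum.inl (Fin.castLE hr i)) * FreeAlgebra.ι k (Sum.inr i) + 1)
  | xy_ne (i : Fin r) (j : Fin n) (hij : Fin.castLE hr i ≠ j) :
      MixedCrossedRel k Λ r hr
        (FreeAlgebra.ι k (Sum.inr i) * FreeAlgebra.ι k (Sum.inl j))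
        (algebraMap k _ (Λ (Fin.castLE hr i) j)⁻¹ *
          (FreeAlgebra.ι k (Sum.inl j) * FreeAlgebra.ι k (Sum.inr i)))
  | xx (i j : Fin r) :
      MixedCrossedRel k Λ r hr
        (FreeAlgebra.ι k (Sum.inr i) * FreeAlgebra.ι k (Sum.inr j))
        (algebraMap k _ (Λ (Fin.castLE hr i) (Fin.castLE hr j)) *
          (FreeAlgebra.ι k (Sum.inr j) * FreeAlgebra.ι k (Sum.inr i)))

/-- The mixed crossed polynomial algebra `S_{n,r}^Λ(k)`. -/
def MixedCrossedAlgebra (k : Type u) [Field k] {n : ℕ} (Λ : Matrix (Fin n) (Fin n) k)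
    (r : ℕ) (hr : r ≤ n) :=
  RingQuot (MixedCrossedRel k Λ r hr)

noncomputable instance (k : Type u) [Field k] {n : ℕ} (Λ : Matrix (Fin n) (Fin n) k)
    (r : ℕ) (hr : r ≤ n) : Ring (MixedCrossedAlgebra k Λ r hr) := by
  unfold MixedCrossedAlgebra; infer_instance

noncomputable instance (k : Type u) [Field k] {n : ℕ} (Λ : Matrix (Fin n) (Fin n) k)
    (r : ℕ) (hr : r ≤ n) : Algebra k (MixedCrossedAlgebra k Λ r hr) := by
  unfold MixedCrossedAlgebra; infer_instance

/-- The generator `y_j` of `S_{n,r}^Λ(k)`. -/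
noncomputable def MixedCrossedAlgebra.y (k : Type u) [Field k] {n : ℕ}
    (Λ : Matrix (Fin n) (Fin n) k) (r : ℕ) (hr : r ≤ n) (j : Fin n) :
    MixedCrossedAlgebra k Λ r hr :=
  RingQuot.mkAlgHom k (MixedCrossedRel k Λ r hr) (FreeAlgebra.ι k (Sum.inl j))

/-- The generator `x_i` of `S_{n,r}^Λ(k)`. -/
noncomputable def MixedCrossedAlgebra.x (k : Type u) [Field k] {n : ℕ}
    (Λ : Matrix (Fin n) (Fin n) k) (r : ℕ) (hr : r ≤ n) (i : Fin r) :
    MixedCrossedAlgebra k Λ r hr :=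
  RingQuot.mkAlgHom k (MixedCrossedRel k Λ r hr) (FreeAlgebra.ι k (Sum.inr i))


structure FractionDivisionRing (k : Type u) [Field k] (A : Type u) [Ring A] [Algebra k A] where
  carrier : Type u
  [divisionRing : DivisionRing carrier]
  [algebra : Algebra k carrier]
  emb : A →ₐ[k] carrier
  emb_injective : Function.Injective emb
  frac : ∀ d : carrier, ∃ a b : A, b ≠ 0 ∧ d = emb a * (emb b)⁻¹

attribute [instance] FractionDivisionRing.divisionRing FractionDivisionRing.algebra

section Shift
variable {k : Type*} [Field k] {ι : Type*}

open MvPolynomial in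
/-- Translation of the variables leaves the leading coefficient of a polynomial unchanged. -/
theorem MonomialOrder.leadingCoeff_aeval_X_sub_C [Fintype ι] (m : MonomialOrder ι) (s : ι → k)
    (p : MvPolynomial ι k) :
    m.leadingCoeff (aeval (fun i => X i - C (s i) : ι → MvPolynomial ι k) p) =
      m.leadingCoeff p := by
  classical
  set Q : (ι →₀ ℕ) → MvPolynomial ι k := fun e => ∏ i, (X i - C (s i)) ^ e i
  have hQm (e : ι →₀ ℕ) : m.Monic (Q e) :=
    MonomialOrder.Monic.prod fun i _ => (m.monic_X_sub_C i (s i)).pow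
  have hQd (e : ι →₀ ℕ) : m.degree (Q e) = e := by
    rw [MonomialOrder.degree_prod fun i _ => ((m.monic_X_sub_C i (s i)).pow).ne_zero]
    simp only [MonomialOrder.degree_pow, MonomialOrder.degree_X_sub_C]
    simp
  have hp : aeval (fun i => X i - C (s i) : ι → MvPolynomial ι k) p =
      ∑ e ∈ p.support, C (p.coeff e) * Q e := by
    rw [aeval_def, eval₂_eq']
    rfl
  by_cases h0 : p = 0
  · simp [h0]
  have hcoeff (d : ι →₀ ℕ) (hd : m.toSyn (m.degree p) ≤ m.toSyn d) :
      (∑ e ∈ p.support, C (p.coeff e) * Q e).coeff d = p.coeff d := by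
    rw [coeff_sum, Finset.sum_eq_single d]
    · have := (hQm d).coeff_degree
      rw [hQd] at this
      rw [coeff_C_mul, this, mul_one]
    · intro e he hed
      rw [coeff_C_mul, m.coeff_eq_zero_of_lt (f := Q e), mul_zero]
      rw [hQd]
      refine lt_of_le_of_ne ((m.le_degree he).trans hd) fun h => hed (m.toSyn.injective h)
    · intro hds
      simp [notMem_support_iff.mp hds]
  rw [hp]
  have hdeg : m.degree (∑ e ∈ p.support, C (p.coeff e) * Q e) = m.degree p := by
    apply m.toSyn.injective
    apply le_antisymm
    · rw [MonomialOrder.degree_le_iff]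
      intro d hd
      by_contra! hlt
      rw [mem_support_iff, hcoeff d hlt.le] at hd
      exact hd (m.coeff_eq_zero_of_lt hlt)
    · apply m.le_degree
      rw [mem_support_iff, hcoeff _ le_rfl]
      exact (m.coeff_degree_ne_zero_iff).mpr h0
  rw [MonomialOrder.leadingCoeff, hdeg, hcoeff _ le_rfl, MonomialOrder.leadingCoeff]

open MvPolynomial IsMulCommutative in
/-- Pairwise commuting elements of a `k`-algebra can be substituted for the variables. -/
theorem MvPolynomial.exists_algHom_of_commute {B : Type*} [Ring B] [Algebra k B] (Θ : ι → B)
    (h : ∀ i j, Θ i * Θ j = Θ j * Θ i) :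
    ∃ φ : MvPolynomial ι k →ₐ[k] B, ∀ i, φ (X i) = Θ i := by
  have hc : ∀ a ∈ Set.range Θ, ∀ b ∈ Set.range Θ, a * b = b * a := by
    rintro _ ⟨i, rfl⟩ _ ⟨j, rfl⟩
    exact h i j
  have := Algebra.isMulCommutative_adjoin k hc
  refine ⟨(Algebra.adjoin k (Set.range Θ)).val.comp
    (aeval fun i => (⟨Θ i, Algebra.subset_adjoin ⟨i, rfl⟩⟩ : Algebra.adjoin k (Set.range Θ))),
    fun i => ?_⟩
  simp
end Shift

section Ore

/-- A multiplicative map from the nonzero elements of a ring to a group extends to the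
division ring of right fractions. -/
theorem exists_extend_to_fractions {A D H : Type*} [Ring A] [DivisionRing D] [Group H]
    (e : A →+* D) (he : Function.Injective e)
    (hfrac : ∀ d : D, ∃ a b : A, b ≠ 0 ∧ d = e a * (e b)⁻¹)
    (v : A → H) (hv : ∀ a b, a ≠ 0 → b ≠ 0 → v (a * b) = v a * v b) :
    ∃ w : D → H, (∀ x y, x ≠ 0 → y ≠ 0 → w (x * y) = w x * w y) ∧
      ∀ a, a ≠ 0 → w (e a) = v a := by
  have he0 {a : A} (ha : a ≠ 0) : e a ≠ 0 := (map_ne_zero_iff e he).mpr ha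
  have hmul {a b : A} (ha : a ≠ 0) (hb : b ≠ 0) : a * b ≠ 0 := fun h =>
    mul_ne_zero (he0 ha) (he0 hb) (by rw [← map_mul, h, map_zero])
  have ore (b d : A) (hb : b ≠ 0) (hd : d ≠ 0) : ∃ p q, p ≠ 0 ∧ q ≠ 0 ∧ b * p = d * q := by
    obtain ⟨p, q, hq, h⟩ := hfrac ((e b)⁻¹ * e d)
    have hp : p ≠ 0 := by
      rintro rfl
      rw [map_zero, zero_mul] at h
      exact mul_ne_zero (inv_ne_zero (he0 hb)) (he0 hd) h
    refine ⟨p, q, hp, hq, he ?_⟩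
    rw [map_mul, map_mul, ← mul_inv_eq_iff_eq_mul₀ (he0 hq), mul_assoc, ← h,
      mul_inv_cancel_left₀ (he0 hb)]
  have key (a b c d : A) (ha : a ≠ 0) (hb : b ≠ 0) (hc : c ≠ 0) (hd : d ≠ 0)
      (h : e a * (e b)⁻¹ = e c * (e d)⁻¹) : v a * (v b)⁻¹ = v c * (v d)⁻¹ := by
    obtain ⟨p, q, hp, hq, hpq⟩ := ore b d hb hd
    have h1 : a * p = c * q := by
      apply he
      have h2 : e b * e p = e d * e q := by rw [← map_mul, hpq, map_mul]
      rw [map_mul, map_mul]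
      calc e a * e p = e a * (e b)⁻¹ * (e b * e p) := by
            rw [mul_assoc, inv_mul_cancel_left₀ (he0 hb)]
        _ = e c * (e d)⁻¹ * (e d * e q) := by rw [h, h2]
        _ = e c * e q := by rw [mul_assoc, inv_mul_cancel_left₀ (he0 hd)]
    have h3 := congrArg v h1
    have h4 := congrArg v hpq
    rw [hv _ _ ha hp, hv _ _ hc hq] at h3
    rw [hv _ _ hb hp, hv _ _ hd hq] at h4
    rw [eq_mul_inv_of_mul_eq h3, eq_mul_inv_of_mul_eq h4]
    group
  choose N M hM hNM using hfrac
  have hN {x : D} (hx : x ≠ 0) : N x ≠ 0 := by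
    intro h
    apply hx
    rw [hNM x, h, map_zero, zero_mul]
  have hne1 {x : D} (hx : x ≠ 0) : (1 : A) ≠ 0 := fun h =>
    hN hx (by rw [← mul_one (N x), h, mul_zero])
  refine ⟨fun x => v (N x) * (v (M x))⁻¹, fun x y hx hy => ?_, fun a ha => ?_⟩
  · obtain ⟨p, q, hp, hq, hpq⟩ := ore (M x) (N y) (hM x) (hN hy)
    have h2 : (e p) * (e q)⁻¹ = (e (M x))⁻¹ * e (N y) := by
      rw [mul_inv_eq_iff_eq_mul₀ (he0 hq), mul_assoc, eq_inv_mul_iff_mul_eq₀ (he0 (hM x)),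
        ← map_mul, hpq, map_mul]
    have h := key (N (x * y)) (M (x * y)) (N x * p) (M y * q) (hN (mul_ne_zero hx hy)) (hM _)
      (hmul (hN hx) hp) (hmul (hM y) hq) (by
        rw [← hNM, map_mul, map_mul, mul_inv_rev, mul_assoc, ← mul_assoc (e p), h2]
        conv_lhs => rw [hNM x, hNM y]
        simp only [mul_assoc])
    have h4 := congrArg v hpq
    rw [hv _ _ (hM x) hp, hv _ _ (hN hy) hq] at h4
    change v (N (x * y)) * (v (M (x * y)))⁻¹ = _
    rw [h, hv _ _ (hN hx) hp, hv _ _ (hM y) hq, eq_inv_mul_of_mul_eq h4]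
    group
  · have h1 : (1 : A) ≠ 0 := hne1 (he0 ha)
    have hv1 : v 1 = 1 := by simpa using hv 1 1 h1 h1
    have := key (N (e a)) (M (e a)) a 1 (hN (he0 ha)) (hM _) ha h1 (by rw [← hNM]; simp)
    simpa [hv1] using this
end Ore

/-- The data of a twisted crossed product of a commutative algebra `P` with an abelian group `G`:
an action of `G` on `P` together with a scalar-valued bicharacter. -/
structure CrossedData (k P G : Type*) [Field k] [CommRing P] [Algebra k P] [AddCommGroup G] where
  act : G → P →ₐ[k] P
  act_zero : ∀ p, act 0 p = p
  act_add : ∀ a b p, act (a + b) p = act a (act b p)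
  char : G → G → kˣ
  char_add_left : ∀ a b c, char (a + b) c = char a c * char b c
  char_add_right : ∀ a b c, char a (b + c) = char a b * char a c

namespace CrossedData

variable {k P G : Type*} [Field k] [CommRing P] [Algebra k P] [AddCommGroup G]
  (T : CrossedData k P G)

@[simp] theorem char_zero_left (a : G) : T.char 0 a = 1 := by
  simpa using T.char_add_left 0 0 a

@[simp] theorem char_zero_right (a : G) : T.char a 0 = 1 := by
  simpa using T.char_add_right a 0 0

@[simp] theorem char_neg_left (a b : G) : T.char (-a) b = (T.char a b)⁻¹ := by
  rw [eq_inv_iff_mul_eq_one, ← T.char_add_left, neg_add_cancel, T.char_zero_left]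

@[simp] theorem char_neg_right (a b : G) : T.char a (-b) = (T.char a b)⁻¹ := by
  rw [eq_inv_iff_mul_eq_one, ← T.char_add_right, neg_add_cancel, T.char_zero_right]

/-- The twisted crossed product: finite sums `∑ p_a u^a` with multiplication
`(p u^a) (q u^b) = char a b • (p * act a q) u^(a+b)`. -/
def Alg (_ : CrossedData k P G) : Type _ := G →₀ P

noncomputable instance : AddCommGroup T.Alg := inferInstanceAs (AddCommGroup (G →₀ P))

noncomputable instance : Module k T.Alg := inferInstanceAs (Module k (G →₀ P))

/-- The element `p u^a` of the crossed product. -/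
noncomputable def single (a : G) : P →+ T.Alg := Finsupp.singleAddHom a

/-- The coefficient of `u^a`. -/
def coeff (f : T.Alg) (a : G) : P := DFunLike.coe (F := G →₀ P) f a

theorem alg_induction {motive : T.Alg → Prop} (f : T.Alg) (zero : motive 0)
    (add : ∀ f g, motive f → motive g → motive (f + g))
    (single : ∀ a p, motive (T.single a p)) : motive f :=
  Finsupp.induction_linear f zero add single

theorem smul_single (c : k) (a : G) (p : P) : c • T.single a p = T.single a (c • p) :=
  Finsupp.smul_single c a p

/-- Additive maps out of the crossed product. -/
noncomputable def liftAdd {M : Type*} [AddCommMonoid M] (φ : G → P →+ M) : T.Alg →+ M :=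
  Finsupp.liftAddHom φ

@[simp] theorem liftAdd_single {M : Type*} [AddCommMonoid M] (φ : G → P →+ M) (a : G) (p : P) :
    T.liftAdd φ (T.single a p) = φ a p :=
  Finsupp.liftAddHom_apply_single φ a p

/-- Multiplication of the crossed product as a biadditive map. -/
noncomputable def mulHom : T.Alg →+ T.Alg →+ T.Alg :=
  T.liftAdd fun a =>
    AddMonoidHom.flip (T.liftAdd fun b => AddMonoidHom.flip
      { toFun := fun p => (T.single (a + b)).comp
          ((DistribSMul.toAddMonoidHom P (T.char a b)).comp
            ((AddMonoidHom.mulLeft p).comp (T.act a : P →+ P)))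
        map_zero' := by ext; simp
        map_add' := fun p q => by
          ext x
          simp [add_mul] })

theorem mulHom_single (a b : G) (p q : P) :
    T.mulHom (T.single a p) (T.single b q) = T.single (a + b) (T.char a b • (p * T.act a q)) := by
  simp [mulHom]

noncomputable instance : Mul T.Alg := ⟨fun f g => T.mulHom f g⟩

noncomputable instance : One T.Alg := ⟨T.single 0 1⟩

theorem one_def : (1 : T.Alg) = T.single 0 1 := rfl

theorem single_mul_single (a b : G) (p q : P) :
    T.single a p * T.single b q = T.single (a + b) (T.char a b • (p * T.act a q)) :=
  T.mulHom_single a b p q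

noncomputable instance : Ring T.Alg :=
  have hl (f g h : T.Alg) : f * (g + h) = f * g + f * h := map_add (T.mulHom f) g h
  have hr (f g h : T.Alg) : (f + g) * h = f * h + g * h :=
    DFunLike.congr_fun (map_add T.mulHom f g) h
  have hz (f : T.Alg) : 0 * f = 0 := DFunLike.congr_fun (map_zero T.mulHom) f
  have hz' (f : T.Alg) : f * 0 = 0 := map_zero (T.mulHom f)
  { (inferInstance : AddCommGroup T.Alg) with
    left_distrib := hl
    right_distrib := hr
    zero_mul := hz
    mul_zero := hz'
    one_mul := fun f => by
      induction f using T.alg_induction with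
      | zero => rw [hz']
      | add f g hf hg => rw [hl, hf, hg]
      | single a p => simp [one_def, single_mul_single, T.act_zero]
    mul_one := fun f => by
      induction f using T.alg_induction with
      | zero => rw [hz]
      | add f g hf hg => rw [hr, hf, hg]
      | single a p => simp [one_def, single_mul_single]
    mul_assoc := fun f g h => by
      induction f using T.alg_induction with
      | zero => simp only [hz]
      | add f f' hf hf' => simp only [hr, hf, hf']
      | single a p =>
        induction g using T.alg_induction with
        | zero => simp only [hz, hz']
        | add g g' hg hg' => simp only [hr, hl, hg, hg']
        | single b q =>
          induction h using T.alg_induction with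
          | zero => simp only [hz']
          | add h h' hh hh' => simp only [hl, hh, hh']
          | single c s =>
            have hs : ∀ (u : kˣ) (x : P), T.act a (u • x) = u • T.act a x := fun u x =>
              map_smul (T.act a) (u : k) x
            simp only [single_mul_single, T.char_add_left, T.char_add_right, T.act_add,
              map_mul, hs, add_assoc, mul_smul_comm, smul_mul_assoc, smul_smul]
            congr 2
            · ac_rfl
            · ac_rfl }

noncomputable instance : Algebra k T.Alg :=
  Algebra.ofModule
    (fun c f g => by
      induction f using T.alg_induction with
      | zero => simp
      | add f f' hf hf' => simp only [smul_add, add_mul, hf, hf']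
      | single a p =>
        induction g using T.alg_induction with
        | zero => simp
        | add g g' hg hg' => simp only [smul_add, mul_add, hg, hg']
        | single b q =>
          simp only [smul_single, single_mul_single, smul_mul_assoc, smul_comm c])
    (fun c f g => by
      induction f using T.alg_induction with
      | zero => simp
      | add f f' hf hf' => simp only [smul_add, add_mul, hf, hf']
      | single a p =>
        induction g using T.alg_induction with
        | zero => simp
        | add g g' hg hg' => simp only [smul_add, mul_add, hg, hg']
        | single b q =>
          simp only [smul_single, single_mul_single, map_smul, mul_smul_comm, smul_comm c])

theorem algebraMap_eq (c : k) : algebraMap k T.Alg c = T.single 0 (algebraMap k P c) := by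
  rw [Algebra.algebraMap_eq_smul_one, one_def, smul_single, Algebra.algebraMap_eq_smul_one]

theorem coeff_single (a b : G) (p : P) [Decidable (a = b)] :
    T.coeff (T.single a p) b = if a = b then p else 0 :=
  Finsupp.single_apply

theorem coeff_sum {ι : Type*} (s : Finset ι) (f : ι → T.Alg) (a : G) :
    T.coeff (∑ i ∈ s, f i) a = ∑ i ∈ s, T.coeff (f i) a :=
  Finsupp.finsetSum_apply s f a

theorem exists_eq_sum (f : T.Alg) :
    ∃ s : Finset G, (∀ a, a ∈ s ↔ T.coeff f a ≠ 0) ∧ f = ∑ a ∈ s, T.single a (T.coeff f a) :=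
  ⟨Finsupp.support (M := P) f, fun _ => Finsupp.mem_support_iff,
    (Finsupp.sum_single (M := P) f).symm⟩

section Lead

variable {Γ : Type*} [AddCommGroup Γ] [LinearOrder Γ] [IsOrderedCancelAddMonoid Γ]
  (o : G →+ Γ)

/-- `p u^a` is the leading term of `f` for the order on `G` induced by `o`. -/
def IsLead (f : T.Alg) (a : G) (p : P) : Prop :=
  T.coeff f a = p ∧ p ≠ 0 ∧ ∀ b, T.coeff f b ≠ 0 → o b ≤ o a

omit [IsOrderedCancelAddMonoid Γ] in
theorem exists_isLead {f : T.Alg} (hf : f ≠ 0) : ∃ a p, T.IsLead o f a p := by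
  obtain ⟨s, hs, hfs⟩ := T.exists_eq_sum f
  have hne : s.Nonempty := by
    rw [Finset.nonempty_iff_ne_empty]
    rintro rfl
    exact hf (by simpa using hfs)
  obtain ⟨a, ha, hmax⟩ := Finset.exists_max_image s o hne
  exact ⟨a, _, rfl, (hs a).mp ha, fun b hb => hmax b ((hs b).mpr hb)⟩

variable {T o}

omit [IsOrderedCancelAddMonoid Γ] in
theorem IsLead.unique (ho : Function.Injective o) {f : T.Alg} {a b : G} {p q : P}
    (h : T.IsLead o f a p) (h' : T.IsLead o f b q) : a = b ∧ p = q := by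
  obtain ⟨h1, h2, h3⟩ := h
  obtain ⟨h1', h2', h3'⟩ := h'
  have : a = b := ho (le_antisymm (h3' a (h1 ▸ h2)) (h3 b (h1' ▸ h2')))
  subst this
  exact ⟨rfl, h1.symm.trans h1'⟩

theorem IsLead.mul [IsDomain P] (ho : Function.Injective o)
    (hact : ∀ a p, p ≠ 0 → T.act a p ≠ 0) {f g : T.Alg} {a b : G} {p q : P}
    (h : T.IsLead o f a p) (h' : T.IsLead o g b q) :
    T.IsLead o (f * g) (a + b) (T.char a b • (p * T.act a q)) := by
  classical
  obtain ⟨rfl, h2, h3⟩ := h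
  obtain ⟨rfl, h2', h3'⟩ := h'
  obtain ⟨s, hs, hfs⟩ := T.exists_eq_sum f
  obtain ⟨t, ht, hgt⟩ := T.exists_eq_sum g
  have hcoeff (d : G) : T.coeff (f * g) d = ∑ x ∈ s ×ˢ t, if x.1 + x.2 = d then
      T.char x.1 x.2 • (T.coeff f x.1 * T.act x.1 (T.coeff g x.2)) else 0 := by
    conv_lhs => rw [hfs, hgt]
    rw [Finset.sum_mul_sum, ← Finset.sum_product', T.coeff_sum]
    simp only [single_mul_single, coeff_single]
  refine ⟨?_, ?_, fun d hd => ?_⟩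
  · rw [hcoeff, Finset.sum_eq_single (a, b)]
    · simp
    · rintro ⟨x, y⟩ hxy hne
      rw [Finset.mem_product] at hxy
      refine if_neg fun hsum => hne ?_
      have hx := h3 x ((hs x).mp hxy.1)
      have hy := h3' y ((ht y).mp hxy.2)
      have hsum' : o x + o y = o a + o b := by rw [← map_add, ← map_add, hsum]
      have hxa : o x = o a := by
        refine le_antisymm hx (not_lt.mp fun hlt => ?_)
        exact (add_lt_add_of_lt_of_le hlt hy).ne hsum'
      rw [hxa] at hsum'
      rw [ho hxa, ho (add_left_cancel hsum')]
    · intro hn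
      exact absurd (Finset.mem_product.mpr ⟨(hs a).mpr h2, (ht b).mpr h2'⟩) hn
  · rw [Units.smul_def]
    exact smul_ne_zero (Units.ne_zero _) (mul_ne_zero h2 (hact _ _ h2'))
  · rw [hcoeff] at hd
    obtain ⟨⟨x, y⟩, hxy, hne⟩ := Finset.exists_ne_zero_of_sum_ne_zero hd
    rw [Finset.mem_product] at hxy
    have hsum : x + y = d := by
      by_contra hcon
      exact hne (if_neg hcon)
    rw [← hsum, map_add, map_add]
    exact add_le_add (h3 x ((hs x).mp hxy.1)) (h3' y ((ht y).mp hxy.2))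

end Lead

/-- Universal property of the crossed product. -/
theorem exists_algHom {B : Type*} [Ring B] [Algebra k B] (φ : P →ₐ[k] B) (Y : G → B)
    (hY0 : Y 0 = 1)
    (hY : ∀ a b, Y a * Y b = algebraMap k B (T.char a b) * Y (a + b))
    (hφ : ∀ a p, Y a * φ p = φ (T.act a p) * Y a) :
    ∃ ψ : T.Alg →ₐ[k] B, ∀ a p, ψ (T.single a p) = φ p * Y a := by
  let ψ₀ : T.Alg →+ B := T.liftAdd fun a => (AddMonoidHom.mulRight (Y a)).comp (φ : P →+ B)
  have h₀ (a : G) (p : P) : ψ₀ (T.single a p) = φ p * Y a := by simp [ψ₀]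
  have h1 : ψ₀ 1 = 1 := by rw [one_def, h₀, map_one, hY0, mul_one]
  have hm (f g : T.Alg) : ψ₀ (f * g) = ψ₀ f * ψ₀ g := by
    induction f using T.alg_induction with
    | zero => simp
    | add f f' hf hf' => rw [add_mul, map_add, map_add, add_mul, hf, hf']
    | single a p =>
      induction g using T.alg_induction with
      | zero => simp
      | add g g' hg hg' => rw [mul_add, map_add, map_add, mul_add, hg, hg']
      | single b q =>
        have hY' : Y a * Y b = (T.char a b : k) • Y (a + b) := by rw [hY, Algebra.smul_def]
        rw [single_mul_single, h₀, h₀, h₀, Units.smul_def, map_smul, map_mul, mul_assoc (φ p),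
          ← mul_assoc (Y a), hφ, mul_assoc (φ _) (Y a), hY', mul_smul_comm, mul_smul_comm,
          smul_mul_assoc, mul_assoc]
  let ψ : T.Alg →+* B := { ψ₀ with map_one' := h1, map_mul' := hm }
  refine ⟨{ ψ with commutes' := fun c => ?_ }, h₀⟩
  change ψ₀ (algebraMap k T.Alg c) = _
  rw [algebraMap_eq, h₀, hY0, mul_one, AlgHom.commutes]

end CrossedData

section Monomials

/-- The bicharacter of `ℤⁿ` attached to a matrix `L`, only whose entries below the diagonal
matter. -/
def torusChar {C : Type*} [CommGroup C] {n : ℕ} (L : Fin n → Fin n → C) (a b : Fin n → ℤ) : C :=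
  ∏ i, ∏ j, if j < i then L i j ^ (a i * b j) else 1

variable {C : Type*} [CommGroup C] {n : ℕ} (L : Fin n → Fin n → C)

theorem torusChar_add_left (a b c : Fin n → ℤ) :
    torusChar L (a + b) c = torusChar L a c * torusChar L b c := by
  simp only [torusChar, ← Finset.prod_mul_distrib]
  refine Finset.prod_congr rfl fun i _ => Finset.prod_congr rfl fun j _ => ?_
  split_ifs <;> simp [add_mul, zpow_add]

theorem torusChar_add_right (a b c : Fin n → ℤ) :
    torusChar L a (b + c) = torusChar L a b * torusChar L a c := by
  simp only [torusChar, ← Finset.prod_mul_distrib]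
  refine Finset.prod_congr rfl fun i _ => Finset.prod_congr rfl fun j _ => ?_
  split_ifs <;> simp [mul_add, zpow_add]

theorem torusChar_single (s t : Fin n) :
    torusChar L (Pi.single s 1) (Pi.single t 1) = if t < s then L s t else 1 := by
  rw [torusChar, Finset.prod_eq_single s, Finset.prod_eq_single t]
  · simp
  · intro j _ hj
    simp [hj]
  · simp
  · intro i _ hi
    simp [hi]
  · simp

theorem torusChar_single_mul (h1 : ∀ i, L i i = 1) (h2 : ∀ i j, L i j * L j i = 1)
    (s t : Fin n) :
    torusChar L (Pi.single s 1) (Pi.single t 1) =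
      L s t * torusChar L (Pi.single t 1) (Pi.single s 1) := by
  rw [torusChar_single, torusChar_single]
  rcases lt_trichotomy s t with h | rfl | h
  · simp [h, h.not_gt, h2]
  · simp [h1]
  · simp [h, h.not_gt]

variable {U : Type*} [Group U]

/-- The ordered monomial `Y_0^{a_0} ⋯ Y_{n-1}^{a_{n-1}}`. -/
def orderedMonomial {n : ℕ} (Y : Fin n → U) (a : Fin n → ℤ) : U :=
  (List.ofFn fun i => Y i ^ a i).prod

theorem orderedMonomial_succ {n : ℕ} (Y : Fin (n + 1) → U) (a : Fin (n + 1) → ℤ) :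
    orderedMonomial Y a =
      Y 0 ^ a 0 * orderedMonomial (fun i => Y i.succ) (fun i => a i.succ) := by
  simp [orderedMonomial, List.ofFn_succ]

theorem orderedMonomial_zero {n : ℕ} (Y : Fin n → U) : orderedMonomial Y 0 = 1 := by
  simp [orderedMonomial]

theorem orderedMonomial_single {n : ℕ} (Y : Fin n → U) (s : Fin n) (m : ℤ) :
    orderedMonomial Y (Pi.single s m) = Y s ^ m := by
  induction n with
  | zero => exact s.elim0
  | succ n ih =>
    rw [orderedMonomial_succ]
    refine Fin.cases ?_ (fun s => ?_) s
    · have : (fun i : Fin n => (Pi.single (0 : Fin (n + 1)) m : Fin (n + 1) → ℤ) i.succ) =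
          0 := by ext i; simp
      rw [this, orderedMonomial_zero]
      simp
    · have : (fun i : Fin n => (Pi.single s.succ m : Fin (n + 1) → ℤ) i.succ) =
          Pi.single s m := by ext i; simp [Pi.single_apply]
      rw [this, ih]
      simp

theorem map_orderedMonomial {V : Type*} [Group V] (φ : U →* V) {n : ℕ} (Y : Fin n → U)
    (a : Fin n → ℤ) : φ (orderedMonomial Y a) = orderedMonomial (fun i => φ (Y i)) a := by
  simp [orderedMonomial, map_list_prod, List.map_ofFn, Function.comp_def]

variable (ι : C →* U) (hι : ∀ c u, ι c * u = u * ι c)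
include hι

theorem zpow_mul_zpow_of_mul_eq {y z : U} {c : C} (h : y * z = ι c * (z * y)) (p q : ℤ) :
    y ^ p * z ^ q = ι (c ^ (p * q)) * (z ^ q * y ^ p) := by
  have comm (d : C) (u : U) : Commute (ι d) u := hι d u
  have h1 : MulAut.conj y z = ι c * z := by
    rw [MulAut.conj_apply, h, mul_assoc, mul_inv_cancel_right]
  have h2 : y * z ^ q * y⁻¹ = ι (c ^ q) * z ^ q := by
    rw [← MulAut.conj_apply, map_zpow, h1, (comm c z).mul_zpow, map_zpow]
  have h3 : MulAut.conj (z ^ q)⁻¹ y = ι (c ^ q) * y := by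
    rw [MulAut.conj_apply, inv_inv, mul_assoc, inv_mul_eq_iff_eq_mul, ← mul_assoc, ← hι, ← h2,
      inv_mul_cancel_right]
  have h4 : (z ^ q)⁻¹ * y ^ p * z ^ q = ι (c ^ (p * q)) * y ^ p := by
    have := MulAut.conj_apply (z ^ q)⁻¹ (y ^ p)
    rw [inv_inv] at this
    rw [← this, map_zpow, h3, (comm _ y).mul_zpow, ← map_zpow, ← zpow_mul, mul_comm q p]
  rw [mul_assoc, inv_mul_eq_iff_eq_mul] at h4
  rw [h4, ← mul_assoc, ← hι, mul_assoc]

theorem orderedMonomial_mul_zpow {n : ℕ} {Y : Fin n → U} {z : U} {c : Fin n → C}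
    (h : ∀ i, Y i * z = ι (c i) * (z * Y i)) (a : Fin n → ℤ) (q : ℤ) :
    orderedMonomial Y a * z ^ q =
      ι (∏ i, c i ^ (a i * q)) * (z ^ q * orderedMonomial Y a) := by
  induction n with
  | zero => simp [orderedMonomial]
  | succ n ih =>
    rw [orderedMonomial_succ, mul_assoc, ih (fun i => h i.succ), Fin.prod_univ_succ, map_mul,
      ← mul_assoc, ← hι, mul_assoc, ← mul_assoc (Y 0 ^ a 0),
      zpow_mul_zpow_of_mul_eq ι hι (h 0), hι (c 0 ^ (a 0 * q)) (ι _)]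
    simp only [mul_assoc]

theorem orderedMonomial_mul {n : ℕ} {Y : Fin n → U} {L : Fin n → Fin n → C}
    (h : ∀ i j, Y i * Y j = ι (L i j) * (Y j * Y i)) (a b : Fin n → ℤ) :
    orderedMonomial Y a * orderedMonomial Y b =
      ι (torusChar L a b) * orderedMonomial Y (a + b) := by
  induction n with
  | zero => simp [orderedMonomial, torusChar]
  | succ n ih =>
    have hc : torusChar L a b = (∏ i : Fin n, L i.succ 0 ^ (a i.succ * b 0)) *
        torusChar (fun i j => L i.succ j.succ) (fun i => a i.succ) (fun i => b i.succ) := by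
      simp [torusChar, Fin.prod_univ_succ, Finset.prod_mul_distrib]
    rw [orderedMonomial_succ, orderedMonomial_succ, orderedMonomial_succ, hc, map_mul,
      mul_assoc, ← mul_assoc (orderedMonomial _ _),
      orderedMonomial_mul_zpow ι hι (fun i => h i.succ 0)]
    have := ih (Y := fun i => Y i.succ) (fun i j => h i.succ j.succ)
      (fun i => a i.succ) (fun i => b i.succ)
    rw [mul_assoc, mul_assoc (Y 0 ^ b 0), this, ← mul_assoc, ← hι, Pi.add_apply, zpow_add]
    have e : (fun i : Fin n => (a + b) i.succ) = (fun i => a i.succ) + fun i => b i.succ := rfl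
    rw [e]
    have h1 := hι (torusChar (fun i j => L i.succ j.succ) (fun i => a i.succ) fun i => b i.succ)
    simp only [mul_assoc]
    rw [← mul_assoc (Y 0 ^ b 0), ← h1, mul_assoc, ← mul_assoc (Y 0 ^ a 0), ← h1]
    simp only [mul_assoc]

end Monomials

section Lifts

variable {k : Type u} [Field k] {n : ℕ} {Λ : Matrix (Fin n) (Fin n) k}

/-- The entries of a multiplicatively antisymmetric matrix as units. -/
def Matrix.MulAntisymmetric.unit (hΛ : Λ.MulAntisymmetric) (i j : Fin n) : kˣ :=
  ⟨Λ i j, Λ j i, hΛ.2 i j, hΛ.2 j i⟩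

@[simp] theorem Matrix.MulAntisymmetric.val_unit (hΛ : Λ.MulAntisymmetric) (i j : Fin n) :
    (hΛ.unit i j : k) = Λ i j := rfl

theorem Matrix.MulAntisymmetric.unit_self (hΛ : Λ.MulAntisymmetric) (i : Fin n) :
    hΛ.unit i i = 1 := Units.ext (hΛ.1 i)

theorem Matrix.MulAntisymmetric.unit_mul_unit (hΛ : Λ.MulAntisymmetric) (i j : Fin n) :
    hΛ.unit i j * hΛ.unit j i = 1 := Units.ext (hΛ.2 i j)

namespace QuantumTorus

theorem y_mul_y (i j : Fin n) :
    y k Λ i * y k Λ j = algebraMap k _ (Λ i j) * (y k Λ j * y k Λ i) := by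
  have := RingQuot.mkAlgHom_rel k (QTorusRel.comm (k := k) (Λ := Λ) i j)
  simp only [map_mul, AlgHom.commutes] at this
  exact this

theorem y_mul_yinv (i : Fin n) : y k Λ i * yinv k Λ i = 1 := by
  have := RingQuot.mkAlgHom_rel k (QTorusRel.mul_inv (k := k) (Λ := Λ) i)
  simp only [map_mul, map_one] at this
  exact this

theorem yinv_mul_y (i : Fin n) : yinv k Λ i * y k Λ i = 1 := by
  have := RingQuot.mkAlgHom_rel k (QTorusRel.inv_mul (k := k) (Λ := Λ) i)
  simp only [map_mul, map_one] at this
  exact this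

variable (Λ) in
/-- The generator `y_i` of the quantum torus as a unit. -/
noncomputable def yUnit (i : Fin n) : (QuantumTorus k Λ)ˣ :=
  ⟨y k Λ i, yinv k Λ i, y_mul_yinv i, yinv_mul_y i⟩

/-- Quantum-commuting units define a homomorphism from the quantum torus. -/
theorem exists_lift {B : Type*} [Ring B] [Algebra k B] (Y : Fin n → Bˣ)
    (hY : ∀ i j, (Y i * Y j : B) = algebraMap k B (Λ i j) * (Y j * Y i)) :
    ∃ f : QuantumTorus k Λ →ₐ[k] B, ∀ i, f (y k Λ i) = Y i := by
  let g : FreeAlgebra k (Fin n ⊕ Fin n) →ₐ[k] B :=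
    FreeAlgebra.lift k (Sum.elim (fun i => (Y i : B)) fun i => ((Y i)⁻¹ : Bˣ))
  have hg : ∀ ⦃a b⦄, QTorusRel k Λ a b → g a = g b := by
    intro a b hab
    cases hab with
    | comm i j => simp [g, hY i j]
    | mul_inv i => simp [g]
    | inv_mul i => simp [g]
  refine ⟨RingQuot.liftAlgHom k ⟨g, hg⟩, fun i => ?_⟩
  rw [y]
  erw [RingQuot.liftAlgHom_mkAlgHom_apply]
  simp [g]

/-- A subspace containing `1` and stable under left multiplication by the generators and their
inverses is everything. -/
theorem eq_top_of_mul_mem (W : Submodule k (QuantumTorus k Λ)) (h1 : 1 ∈ W)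
    (hy : ∀ i, ∀ w ∈ W, y k Λ i * w ∈ W) (hy' : ∀ i, ∀ w ∈ W, yinv k Λ i * w ∈ W)
    (z : QuantumTorus k Λ) : z ∈ W := by
  let π : FreeAlgebra k (Fin n ⊕ Fin n) →ₐ[k] QuantumTorus k Λ :=
    RingQuot.mkAlgHom k (QTorusRel k Λ)
  obtain ⟨t, ht⟩ : ∃ t, π t = z := RingQuot.mkAlgHom_surjective k (QTorusRel k Λ) z
  have key : ∀ w ∈ W, π t * w ∈ W := by
    clear ht
    induction t using FreeAlgebra.induction with
    | grade0 c =>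
      intro w hw
      rw [AlgHom.commutes, ← Algebra.smul_def]
      exact W.smul_mem c hw
    | grade1 i =>
      intro w hw
      rcases i with i | i
      · exact hy i w hw
      · exact hy' i w hw
    | mul a b ha hb =>
      intro w hw
      rw [map_mul, mul_assoc]
      exact ha _ (hb w hw)
    | add a b ha hb =>
      intro w hw
      rw [map_add, add_mul]
      exact W.add_mem (ha w hw) (hb w hw)
  have := key 1 h1
  rw [mul_one] at this
  exact ht ▸ this

end QuantumTorus

namespace MixedCrossedAlgebra

variable {r : ℕ} {hr : r ≤ n}

variable (Λ hr) in
/-- Elements of an algebra satisfying the defining relations of `S_{n,r}^Λ(k)`. -/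
structure Relations {B : Type*} [Ring B] [Algebra k B] (Y : Fin n → B) (X : Fin r → B) :
    Prop where
  yy : ∀ i j, Y i * Y j = algebraMap k B (Λ i j) * (Y j * Y i)
  xy_same : ∀ i, X i * Y (Fin.castLE hr i) = Y (Fin.castLE hr i) * X i + 1
  xy_ne : ∀ i j, Fin.castLE hr i ≠ j →
    X i * Y j = algebraMap k B (Λ (Fin.castLE hr i) j)⁻¹ * (Y j * X i)
  xx : ∀ i j, X i * X j =
    algebraMap k B (Λ (Fin.castLE hr i) (Fin.castLE hr j)) * (X j * X i)

theorem relations : Relations Λ hr (y k Λ r hr) (x k Λ r hr) where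
  yy i j := by
    have := RingQuot.mkAlgHom_rel k (MixedCrossedRel.yy (k := k) (Λ := Λ) (r := r) (hr := hr) i j)
    simp only [map_mul, AlgHom.commutes] at this
    exact this
  xy_same i := by
    have := RingQuot.mkAlgHom_rel k
      (MixedCrossedRel.xy_same (k := k) (Λ := Λ) (r := r) (hr := hr) i)
    simp only [map_mul, map_add, map_one] at this
    exact this
  xy_ne i j hij := by
    have := RingQuot.mkAlgHom_rel k
      (MixedCrossedRel.xy_ne (k := k) (Λ := Λ) (r := r) (hr := hr) i j hij)
    simp only [map_mul, AlgHom.commutes] at this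
    exact this
  xx i j := by
    have := RingQuot.mkAlgHom_rel k (MixedCrossedRel.xx (k := k) (Λ := Λ) (r := r) (hr := hr) i j)
    simp only [map_mul, AlgHom.commutes] at this
    exact this

theorem Relations.map {B B' : Type*} [Ring B] [Algebra k B] [Ring B'] [Algebra k B']
    {Y : Fin n → B} {X : Fin r → B} (h : Relations Λ hr Y X) (f : B →ₐ[k] B') :
    Relations Λ hr (fun i => f (Y i)) (fun i => f (X i)) where
  yy i j := by simp only [← map_mul, h.yy i j, ← f.commutes]
  xy_same i := by simp only [← map_mul, h.xy_same i, map_add, map_one]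
  xy_ne i j hij := by simp only [← map_mul, h.xy_ne i j hij, ← f.commutes]
  xx i j := by simp only [← map_mul, h.xx i j, ← f.commutes]

theorem exists_lift {B : Type*} [Ring B] [Algebra k B] {Y : Fin n → B} {X : Fin r → B}
    (h : Relations Λ hr Y X) :
    ∃ f : MixedCrossedAlgebra k Λ r hr →ₐ[k] B,
      (∀ i, f (y k Λ r hr i) = Y i) ∧ ∀ i, f (x k Λ r hr i) = X i := by
  let g : FreeAlgebra k (Fin n ⊕ Fin r) →ₐ[k] B := FreeAlgebra.lift k (Sum.elim Y X)
  have hg : ∀ ⦃a b⦄, MixedCrossedRel k Λ r hr a b → g a = g b := by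
    intro a b hab
    cases hab with
    | yy i j => simp [g, h.yy i j]
    | xy_same i => simp [g, h.xy_same i]
    | xy_ne i j hij => simp only [g, map_mul, FreeAlgebra.lift_ι_apply, AlgHom.commutes,
        Sum.elim_inl, Sum.elim_inr, h.xy_ne i j hij]
    | xx i j => simp [g, h.xx i j]
  refine ⟨RingQuot.liftAlgHom k ⟨g, hg⟩, fun i => ?_, fun i => ?_⟩
  · rw [y]
    erw [RingQuot.liftAlgHom_mkAlgHom_apply]
    simp [g]
  · rw [x]
    erw [RingQuot.liftAlgHom_mkAlgHom_apply]
    simp [g]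

theorem algHom_ext {B : Type*} [Ring B] [Algebra k B]
    {f g : MixedCrossedAlgebra k Λ r hr →ₐ[k] B}
    (hy : ∀ i, f (y k Λ r hr i) = g (y k Λ r hr i))
    (hx : ∀ i, f (x k Λ r hr i) = g (x k Λ r hr i)) : f = g := by
  refine RingQuot.ringQuot_ext' k (s := MixedCrossedRel k Λ r hr) f g ?_
  ext i
  rcases i with i | i
  · exact hy i
  · exact hx i

end MixedCrossedAlgebra

end Lifts

section Crossed

open MvPolynomial

variable {k : Type u} [Field k] {n : ℕ} {Λ : Matrix (Fin n) (Fin n) k} {r : ℕ}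

/-- The crossed product of `k[θ_1, …, θ_r]` with `ℤⁿ` in which
`u^a θ_i = (θ_i - a_i) u^a` and the `u^a` multiply as ordered monomials of the quantum torus. -/
noncomputable def torusCrossedData (hΛ : Λ.MulAntisymmetric) (hr : r ≤ n) :
    CrossedData k (MvPolynomial (Fin r) k) (Fin n → ℤ) where
  act a := aeval fun i => X i - C (a (Fin.castLE hr i) : k)
  act_zero p := by simp
  act_add a b p := by
    rw [← AlgHom.comp_apply]
    congr 1
    ext i : 1
    simp
    ring
  char := torusChar hΛ.unit
  char_add_left := torusChar_add_left _
  char_add_right := torusChar_add_right _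

variable (hΛ : Λ.MulAntisymmetric) (hr : r ≤ n)

theorem torusCrossedData_act_X (a : Fin n → ℤ) (i : Fin r) :
    (torusCrossedData hΛ hr).act a (X i) = X i - C (a (Fin.castLE hr i) : k) := by
  simp [torusCrossedData]

theorem torusCrossedData_char_single_mul (s t : Fin n) :
    (torusCrossedData hΛ hr).char (Pi.single s 1) (Pi.single t 1) =
      hΛ.unit s t * (torusCrossedData hΛ hr).char (Pi.single t 1) (Pi.single s 1) :=
  torusChar_single_mul _ hΛ.unit_self hΛ.unit_mul_unit s t

theorem torusCrossedData_relations :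
    MixedCrossedAlgebra.Relations Λ hr
      (fun j => (torusCrossedData hΛ hr).single (Pi.single j 1) 1)
      (fun i => (torusCrossedData hΛ hr).single (-Pi.single (Fin.castLE hr i) 1) (X i + 1)) := by
  set T := torusCrossedData hΛ hr
  have hact (a : Fin n → ℤ) (i : Fin r) : T.act a (X i) = X i - C (a (Fin.castLE hr i) : k) :=
    torusCrossedData_act_X hΛ hr a i
  have hchar (s t : Fin n) : T.char (Pi.single s 1) (Pi.single t 1) =
      hΛ.unit s t * T.char (Pi.single t 1) (Pi.single s 1) :=
    torusCrossedData_char_single_mul hΛ hr s t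
  have halg (c : kˣ) (f : T.Alg) : algebraMap k T.Alg c * f = (c : k) • f :=
    (Algebra.smul_def _ _).symm
  refine ⟨fun i j => ?_, fun i => ?_, fun i j hij => ?_, fun i j => ?_⟩
  · rw [← hΛ.val_unit i j, halg, T.single_mul_single, T.single_mul_single, T.smul_single,
      hchar i j, add_comm, mul_smul]
    simp [Units.smul_def]
  · rw [T.single_mul_single, T.single_mul_single, T.one_def]
    simp only [T.char_neg_left, T.char_neg_right, map_add, map_one, hact, mul_one, one_mul,
      neg_add_cancel, add_neg_cancel]
    have h1 : T.char (Pi.single (Fin.castLE hr i) 1) (Pi.single (Fin.castLE hr i) 1) = 1 := by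
      change torusChar _ _ _ = _
      rw [torusChar_single]
      simp
    rw [h1, ← map_add]
    simp
  · have hinv : (Λ (Fin.castLE hr i) j)⁻¹ = ((hΛ.unit (Fin.castLE hr i) j)⁻¹ : kˣ) := by
      rw [Units.val_inv_eq_inv_val]; rfl
    rw [hinv, halg, T.single_mul_single, T.single_mul_single, T.smul_single, add_comm]
    simp only [T.char_neg_left, T.char_neg_right, map_add, map_one, hact, mul_one, one_mul]
    rw [hchar, mul_inv, mul_smul]
    simp [Units.smul_def, hij]
  · rw [← hΛ.val_unit, halg, T.single_mul_single, T.single_mul_single, T.smul_single, add_comm]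
    rcases eq_or_ne i j with rfl | hij
    · simp [hΛ.unit_self]
    have hij' : Fin.castLE hr i ≠ Fin.castLE hr j := fun h => hij (Fin.castLE_injective hr h)
    simp only [T.char_neg_left, T.char_neg_right, map_add, map_one, hact, inv_inv]
    rw [hchar, mul_smul, mul_comm (X i + 1)]
    simp [Units.smul_def, hij', hij'.symm]

end Crossed

section CrossedHom

open MvPolynomial

variable {k : Type u} [Field k] {n : ℕ} {Λ : Matrix (Fin n) (Fin n) k} {r : ℕ}
  (hΛ : Λ.MulAntisymmetric) {hr : r ≤ n}

theorem Pi.mem_of_single_mem {n : ℕ} (S : AddSubgroup (Fin n → ℤ))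
    (h : ∀ j, Pi.single j 1 ∈ S) (a : Fin n → ℤ) : a ∈ S := by
  have : a = ∑ j, a j • (Pi.single j 1 : Fin n → ℤ) := by
    ext i
    simp [Finset.sum_apply, Pi.single_apply]
  rw [this]
  exact S.sum_mem fun j _ => S.zsmul_mem (h j) _

/-- Ordered monomials in quantum-commuting units of an algebra. -/
theorem val_orderedMonomial_mul {B : Type*} [Ring B] [Algebra k B] {Y : Fin n → Bˣ}
    (hY : ∀ i j, (Y i * Y j : B) = algebraMap k B (Λ i j) * (Y j * Y i)) (a b : Fin n → ℤ) :
    ((orderedMonomial Y a : Bˣ) : B) * orderedMonomial Y b =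
      algebraMap k B (torusChar hΛ.unit a b : kˣ) * orderedMonomial Y (a + b) := by
  let ι : kˣ →* Bˣ := Units.map (algebraMap k B : k →* B)
  have := orderedMonomial_mul (C := kˣ) (U := Bˣ) (ι := ι)
    (fun c u => Units.ext (Algebra.commutes (c : k) (u : B))) (L := hΛ.unit) (Y := Y)
    (fun i j => Units.ext (hY i j)) a b
  exact congrArg Units.val this

include hΛ in
theorem MixedCrossedAlgebra.Relations.commute_y {B : Type*} [Ring B] [Algebra k B]
    {Y : Fin n → B} {X : Fin r → B} (h : MixedCrossedAlgebra.Relations Λ hr Y X)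
    (i : Fin r) (j : Fin n) (hij : Fin.castLE hr i ≠ j) :
    Commute (Y (Fin.castLE hr i) * X i) (Y j) := by
  have h0 : Λ (Fin.castLE hr i) j ≠ 0 := left_ne_zero_of_mul_eq_one (hΛ.2 _ _)
  have h1 := h.xy_ne i j hij
  have h2 := h.yy (Fin.castLE hr i) j
  rw [← Algebra.smul_def] at h1 h2
  rw [Commute, SemiconjBy, mul_assoc, h1, mul_smul_comm, ← mul_assoc, h2, smul_mul_assoc,
    inv_smul_smul₀ h0, mul_assoc]

include hΛ in
theorem MixedCrossedAlgebra.Relations.commute_x {B : Type*} [Ring B] [Algebra k B]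
    {Y : Fin n → B} {X : Fin r → B} (h : MixedCrossedAlgebra.Relations Λ hr Y X)
    (i j : Fin r) (hij : i ≠ j) : Commute (Y (Fin.castLE hr i) * X i) (X j) := by
  have hji : Fin.castLE hr j ≠ Fin.castLE hr i := fun e => hij (Fin.castLE_injective hr e).symm
  have h0 : Λ (Fin.castLE hr i) (Fin.castLE hr j) ≠ 0 := left_ne_zero_of_mul_eq_one (hΛ.2 _ _)
  have h1 := h.xy_ne j _ hji
  have h2 := h.xx i j
  have hinv : (Λ (Fin.castLE hr j) (Fin.castLE hr i))⁻¹ =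
      Λ (Fin.castLE hr i) (Fin.castLE hr j) := inv_eq_of_mul_eq_one_left (hΛ.2 _ _)
  rw [hinv] at h1
  rw [← Algebra.smul_def] at h1 h2
  rw [Commute, SemiconjBy, mul_assoc, h2, mul_smul_comm, ← mul_assoc (X j), h1, smul_mul_assoc,
    mul_assoc]

/-- Elements satisfying the relations of `S_{n,r}^Λ(k)` with the `y_j` invertible define a
homomorphism from the crossed product. -/
theorem exists_algHom_of_relations {B : Type*} [Ring B] [Algebra k B] (Y : Fin n → Bˣ)
    (X' : Fin r → B) (h : MixedCrossedAlgebra.Relations Λ hr (fun j => (Y j : B)) X') :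
    ∃ ψ : (torusCrossedData hΛ hr).Alg →ₐ[k] B,
      (∀ a, ψ ((torusCrossedData hΛ hr).single a 1) = orderedMonomial Y a) ∧
      ∀ i, ψ ((torusCrossedData hΛ hr).single (-Pi.single (Fin.castLE hr i) 1) (X i + 1)) =
        X' i := by
  set T := torusCrossedData hΛ hr
  have hmul := val_orderedMonomial_mul hΛ h.yy
  obtain ⟨Θ, hΘ⟩ : ∃ Θ : Fin r → B, ∀ i, Θ i = (Y (Fin.castLE hr i) : B) * X' i :=
    ⟨_, fun _ => rfl⟩
  have hΘc (i j : Fin r) : Θ i * Θ j = Θ j * Θ i := by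
    rcases eq_or_ne i j with rfl | hij
    · rfl
    · rw [hΘ, hΘ]
      exact (h.commute_y hΛ i (Fin.castLE hr j)
        fun e => hij (Fin.castLE_injective hr e)).mul_right (h.commute_x hΛ i j hij)
  obtain ⟨φ, hφ⟩ := MvPolynomial.exists_algHom_of_commute (k := k) Θ hΘc
  have hcomm (m : ℤ) (x : B) : (m : B) * x = x * m := Int.cast_comm m x
  have hΘY (i : Fin r) (a : Fin n → ℤ) : ((orderedMonomial Y a : Bˣ) : B) * Θ i =
      (Θ i - (a (Fin.castLE hr i) : B)) * orderedMonomial Y a := by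
    let S : AddSubgroup (Fin n → ℤ) :=
      { carrier := {a | ((orderedMonomial Y a : Bˣ) : B) * Θ i =
          (Θ i - (a (Fin.castLE hr i) : B)) * orderedMonomial Y a}
        zero_mem' := by simp [orderedMonomial_zero]
        add_mem' := fun {a b} ha hb => by
          simp only [Set.mem_ofPred_eq] at ha hb ⊢
          have hu : IsUnit (algebraMap k B (torusChar hΛ.unit a b : kˣ)) :=
            (Units.isUnit _).map _
          apply hu.mul_left_cancel
          rw [← mul_assoc, ← hmul, ← Algebra.left_comm, ← hmul, mul_assoc, hb, ← mul_assoc,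
            mul_sub, ha, ← hcomm, ← sub_mul, ← mul_assoc]
          congr 1
          rw [Pi.add_apply, Int.cast_add, ← sub_sub, sub_mul _ (b _ : B)]
        neg_mem' := fun {a} ha => by
          simp only [Set.mem_ofPred_eq] at ha ⊢
          have hu : IsUnit ((orderedMonomial Y a : Bˣ) : B) := Units.isUnit _
          apply hu.mul_left_cancel
          have h1 := hmul a (-a)
          rw [add_neg_cancel, orderedMonomial_zero, Units.val_one, mul_one] at h1
          rw [← mul_assoc, h1, Pi.neg_apply, Int.cast_neg, sub_neg_eq_add,
            ← mul_assoc (_ : B) (_ + _), mul_add, ha, sub_mul, hcomm, sub_add_cancel,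
            mul_assoc, h1, Algebra.commutes] }
    refine Pi.mem_of_single_mem S (fun j => ?_) a
    change ((orderedMonomial Y (Pi.single j 1) : Bˣ) : B) * Θ i =
      (Θ i - ((Pi.single j 1 : Fin n → ℤ) (Fin.castLE hr i) : B)) *
        orderedMonomial Y (Pi.single j 1)
    rw [orderedMonomial_single, zpow_one]
    rcases eq_or_ne (Fin.castLE hr i) j with rfl | hij
    · rw [Pi.single_eq_same, Int.cast_one, sub_mul, one_mul, hΘ,
        mul_assoc (Y _ : B) (X' i), h.xy_same i, mul_add, mul_one, add_sub_cancel_right]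
    · rw [Pi.single_eq_of_ne hij, Int.cast_zero, sub_zero]
      rw [hΘ]
      exact (h.commute_y hΛ i j hij).symm
  have hφY (a : Fin n → ℤ) (p : MvPolynomial (Fin r) k) :
      ((orderedMonomial Y a : Bˣ) : B) * φ p = φ (T.act a p) * orderedMonomial Y a := by
    induction p using MvPolynomial.induction_on with
    | C c =>
      have h1 : φ (C c) = algebraMap k B c := φ.commutes c
      have h2 : T.act a (C c) = C c := (T.act a).commutes c
      rw [h2, h1, Algebra.commutes]
    | add p q hp hq => rw [map_add, mul_add, hp, hq, map_add, map_add, add_mul]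
    | mul_X p i hp =>
      have h1 : φ (T.act a (X i)) = Θ i - (a (Fin.castLE hr i) : B) := by
        rw [torusCrossedData_act_X, map_sub, hφ]
        congr 1
        exact (φ.commutes _).trans (by simp)
      rw [map_mul, ← mul_assoc, hp, mul_assoc, hφ, hΘY, map_mul, map_mul, h1, mul_assoc]
  obtain ⟨ψ, hψ⟩ := T.exists_algHom φ (fun a => ((orderedMonomial Y a : Bˣ) : B))
    (by simp [orderedMonomial_zero]) hmul hφY
  refine ⟨ψ, fun a => by rw [hψ, map_one, one_mul], fun i => ?_⟩
  rw [hψ, ← Pi.single_neg, orderedMonomial_single, zpow_neg_one, map_add, map_one, hφ, hΘ,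
    ← h.xy_same i, Units.mul_inv_cancel_right]

end CrossedHom

section Value

open MvPolynomial

variable {k : Type u} [Field k] {n : ℕ} {Λ : Matrix (Fin n) (Fin n) k} {r : ℕ}

theorem QuantumTorus.yUnit_mul_yUnit (i j : Fin n) :
    ((yUnit Λ i : QuantumTorus k Λ) * yUnit Λ j) =
      algebraMap k _ (Λ i j) * (yUnit Λ j * yUnit Λ i) := y_mul_y i j

/-- The leading coefficient of the leading term gives a multiplicative map from the nonzero
elements of the crossed product to the units of the quantum torus. -/
theorem exists_value (hΛ : Λ.MulAntisymmetric) (hr : r ≤ n) :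
    ∃ V : (torusCrossedData hΛ hr).Alg → (QuantumTorus k Λ)ˣ,
      (∀ f g, f ≠ 0 → g ≠ 0 → V (f * g) = V f * V g) ∧
      ∀ c : k, c ≠ 0 → (V (algebraMap k _ c) : QuantumTorus k Λ) = algebraMap k _ c := by
  set T := torusCrossedData hΛ hr
  let m : MonomialOrder (Fin r) := MonomialOrder.lex
  let o : (Fin n → ℤ) →+ Lex (Fin n → ℤ) := toLexAddEquiv (Fin n → ℤ)
  have ho : Function.Injective o := (toLexAddEquiv (Fin n → ℤ)).injective
  have hlc (a : Fin n → ℤ) (p : MvPolynomial (Fin r) k) :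
      m.leadingCoeff (T.act a p) = m.leadingCoeff p :=
    m.leadingCoeff_aeval_X_sub_C _ p
  have hact (a : Fin n → ℤ) (p : MvPolynomial (Fin r) k) (hp : p ≠ 0) : T.act a p ≠ 0 := by
    rw [← m.leadingCoeff_ne_zero_iff, hlc]
    exact m.leadingCoeff_ne_zero_iff.mpr hp
  have hex : ∀ f : T.Alg, f ≠ 0 → ∃ t : (QuantumTorus k Λ)ˣ, ∀ a p, T.IsLead o f a p →
      (t : QuantumTorus k Λ) = algebraMap k _ (m.leadingCoeff p) *
        orderedMonomial (QuantumTorus.yUnit Λ) a := by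
    intro f hf
    obtain ⟨a, p, h⟩ := T.exists_isLead o hf
    refine ⟨Units.map (algebraMap k (QuantumTorus k Λ) : k →* QuantumTorus k Λ)
      (Units.mk0 _ (m.leadingCoeff_ne_zero_iff.mpr h.2.1)) *
        orderedMonomial (QuantumTorus.yUnit Λ) a, fun b q h' => ?_⟩
    obtain ⟨rfl, rfl⟩ := h.unique ho h'
    rfl
  choose! V hV using hex
  refine ⟨V, fun f g hf hg => ?_, fun c hc => ?_⟩
  · obtain ⟨a, p, h⟩ := T.exists_isLead o hf
    obtain ⟨b, q, h'⟩ := T.exists_isLead o hg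
    have h2 := h.mul ho hact h'
    have hfg : f * g ≠ 0 := by
      intro h0
      rw [h0] at h2
      exact h2.2.1 h2.1.symm
    have h3 : m.leadingCoeff (T.char a b • (p * T.act a q)) =
        m.leadingCoeff p * m.leadingCoeff q * (T.char a b : k) := by
      rw [Units.smul_def, smul_eq_C_mul, m.leadingCoeff_mul, m.leadingCoeff_mul, hlc,
        m.leadingCoeff_C, mul_comm]
    apply Units.ext
    rw [Units.val_mul, hV _ hfg _ _ h2, hV _ hf _ _ h, hV _ hg _ _ h', h3, map_mul, mul_assoc]
    change _ * (algebraMap k _ (torusChar hΛ.unit a b : kˣ) * _) = _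
    rw [← val_orderedMonomial_mul hΛ QuantumTorus.yUnit_mul_yUnit a b, map_mul, mul_assoc,
      mul_assoc, Algebra.left_comm (Units.val (orderedMonomial _ a))]
  · have h : T.IsLead o (algebraMap k T.Alg c) 0 (C c) := by
      classical
      rw [T.algebraMap_eq]
      refine ⟨by rw [T.coeff_single, if_pos rfl]; rfl, by simpa using hc, fun b hb => ?_⟩
      rw [T.coeff_single] at hb
      rw [(ite_ne_right_iff.mp hb).1]
    have h0 : algebraMap k T.Alg c ≠ 0 := by
      intro h0
      rw [h0] at h
      exact h.2.1 h.1.symm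
    rw [hV _ h0 _ _ h, orderedMonomial_zero, m.leadingCoeff_C, Units.val_one, mul_one]

end Value

namespace CrossedData

variable {k P G : Type*} [Field k] [CommRing P] [Algebra k P] [AddCommGroup G]
  (T : CrossedData k P G)

theorem single_one_ne_zero [Nontrivial P] (a : G) : T.single a 1 ≠ 0 := by
  classical
  intro h
  have := congrArg (fun f => T.coeff f a) h
  simp only [coeff_single] at this
  exact one_ne_zero this

theorem single_add (a b : G) :
    T.single (a + b) 1 = (T.char a b)⁻¹ • (T.single a 1 * T.single b 1) := by
  rw [single_mul_single, map_one (T.act a), mul_one]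
  simp only [Units.smul_def, smul_single, smul_smul, ← Units.val_mul, inv_mul_cancel,
    Units.val_one, one_smul]

/-- Every combination of the `u^a` has a left multiple by some `u^N` in any subalgebra containing
the `u_j`. -/
theorem exists_single_mul_mem {n : ℕ} (T : CrossedData k P (Fin n → ℤ)) (K : Subalgebra k T.Alg)
    (hK : ∀ j, T.single (Pi.single j 1) 1 ∈ K) (c : (Fin n → ℤ) →₀ k) :
    ∃ N, T.single N 1 * Finsupp.linearCombination k (fun a => T.single a 1) c ∈ K := by
  have hsmul (x : kˣ) {f : T.Alg} (hf : f ∈ K) : x • f ∈ K := K.smul_mem hf (x : k)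
  let H : AddSubmonoid (Fin n → ℤ) :=
    { carrier := {a | T.single a 1 ∈ K}
      zero_mem' := K.one_mem
      add_mem' := fun {a b} ha hb => by
        change T.single (a + b) 1 ∈ K
        rw [T.single_add]
        exact hsmul _ (K.mul_mem ha hb) }
  have hpos (a : Fin n → ℤ) (ha : 0 ≤ a) : T.single a 1 ∈ K := by
    have h1 : a = ∑ j, (a j).toNat • (Pi.single j 1 : Fin n → ℤ) := by
      ext i
      simpa [Finset.sum_apply, Pi.single_apply] using ha i
    have h2 : a ∈ H := by
      rw [h1]
      exact H.sum_mem fun j _ => H.nsmul_mem (hK j) _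
    exact h2
  suffices h : ∃ N, 0 ≤ N ∧ T.single N 1 * Finsupp.linearCombination k (fun a => T.single a 1) c ∈ K
    from let ⟨N, _, hN⟩ := h; ⟨N, hN⟩
  induction c using Finsupp.induction_linear with
  | zero => exact ⟨0, le_rfl, by simp⟩
  | add c d hc hd =>
    obtain ⟨N, hN, hc⟩ := hc
    obtain ⟨M, hM, hd⟩ := hd
    refine ⟨N + M, add_nonneg hN hM, ?_⟩
    rw [map_add, mul_add]
    refine K.add_mem ?_ ?_
    · rw [add_comm, T.single_add, smul_mul_assoc, mul_assoc]
      exact hsmul _ (K.mul_mem (hpos M hM) hc)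
    · rw [T.single_add, smul_mul_assoc, mul_assoc]
      exact hsmul _ (K.mul_mem (hpos N hN) hd)
  | single a x =>
    refine ⟨-a ⊔ 0, le_sup_right, ?_⟩
    have h1 : T.single (-a ⊔ 0) 1 * T.single a 1 =
        T.char (-a ⊔ 0) a • T.single (-a ⊔ 0 + a) 1 := by
      rw [T.single_add, smul_smul, mul_inv_cancel, one_smul]
    rw [Finsupp.linearCombination_single, mul_smul_comm, h1]
    exact K.smul_mem (hsmul _ (hpos _ (by
      rw [← neg_le_iff_add_nonneg]; exact le_sup_left))) _

theorem linearCombination_single_injective [Nontrivial P] :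
    Function.Injective (Finsupp.linearCombination k (fun a => T.single a 1)) := by
  classical
  refine (injective_iff_map_eq_zero _).mpr fun c hc => ?_
  ext a
  have h := congrArg (fun f => T.coeff f a) hc
  simp only [Finsupp.linearCombination_apply, Finsupp.sum, coeff_sum,
    smul_single, coeff_single, Finset.sum_ite_eq'] at h
  by_contra hca
  rw [if_pos (by simpa using hca)] at h
  exact hca ((smul_eq_zero.mp h).resolve_right one_ne_zero)

end CrossedData

section Fractions

variable {k : Type u} [Field k] {n : ℕ} {Λ : Matrix (Fin n) (Fin n) k} {r : ℕ}
  (hΛ : Λ.MulAntisymmetric) (hr : r ≤ n)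

variable {D : Type*} [DivisionRing D] [Algebra k D] (e : MixedCrossedAlgebra k Λ r hr →ₐ[k] D)
  (he : Function.Injective e)

include he in
/-- The embedding of `S_{n,r}^Λ(k)` into a division ring factors through the crossed product. -/
theorem exists_factorization_through_crossed :
    ∃ (κ : MixedCrossedAlgebra k Λ r hr →ₐ[k] (torusCrossedData hΛ hr).Alg)
      (ψ : (torusCrossedData hΛ hr).Alg →ₐ[k] D) (Y : Fin n → Dˣ),
      (∀ j, κ (MixedCrossedAlgebra.y k Λ r hr j) =
        (torusCrossedData hΛ hr).single (Pi.single j 1) 1) ∧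
      (∀ s, ψ (κ s) = e s) ∧
      (∀ i j, (Y i * Y j : D) = algebraMap k D (Λ i j) * (Y j * Y i)) ∧
      ∀ a, ψ ((torusCrossedData hΛ hr).single a 1) = ((orderedMonomial Y a : Dˣ) : D) := by
  obtain ⟨κ, hκy, hκx⟩ := MixedCrossedAlgebra.exists_lift (torusCrossedData_relations hΛ hr)
  have hy (j : Fin n) : e (MixedCrossedAlgebra.y k Λ r hr j) ≠ 0 := by
    rw [map_ne_zero_iff e he]
    intro h0
    apply (torusCrossedData hΛ hr).single_one_ne_zero (Pi.single j 1)
    rw [← hκy, h0, map_zero]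
  have hrel := MixedCrossedAlgebra.relations.map e
  obtain ⟨ψ, hψ, hψx⟩ := exists_algHom_of_relations hΛ (fun j => Units.mk0 _ (hy j)) _ hrel
  refine ⟨κ, ψ, _, hκy, fun s => ?_, hrel.yy, hψ⟩
  have : ψ.comp κ = e := by
    refine MixedCrossedAlgebra.algHom_ext (fun j => ?_) fun i => ?_
    · rw [AlgHom.comp_apply, hκy, hψ, orderedMonomial_single, zpow_one, Units.val_mk0]
    · rw [AlgHom.comp_apply, hκx, hψx]
  rw [← this, AlgHom.comp_apply]

include hΛ in
/-- The ordered monomials span the quantum torus. -/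
theorem QuantumTorus.exists_linearCombination (z : QuantumTorus k Λ) :
    ∃ c : (Fin n → ℤ) →₀ k, Finsupp.linearCombination k
      (fun a => ((orderedMonomial (yUnit Λ) a : (QuantumTorus k Λ)ˣ) : QuantumTorus k Λ)) c =
        z := by
  set Z : (Fin n → ℤ) → QuantumTorus k Λ := fun a => (orderedMonomial (yUnit Λ) a : (_)ˣ)
  have hmul (b : Fin n → ℤ) (w : QuantumTorus k Λ)
      (hw : w ∈ Submodule.span k (Set.range Z)) : Z b * w ∈ Submodule.span k (Set.range Z) := by
    induction hw using Submodule.span_induction with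
    | mem w hw =>
      obtain ⟨a, rfl⟩ := hw
      rw [val_orderedMonomial_mul hΛ yUnit_mul_yUnit, ← Algebra.smul_def]
      exact Submodule.smul_mem _ _ (Submodule.subset_span ⟨_, rfl⟩)
    | zero => rw [mul_zero]; exact Submodule.zero_mem _
    | add x y _ _ hx hy => rw [mul_add]; exact Submodule.add_mem _ hx hy
    | smul c x _ hx => rw [mul_smul_comm]; exact Submodule.smul_mem _ _ hx
  have := eq_top_of_mul_mem (Submodule.span k (Set.range Z)) ?_ ?_ ?_ z
  · exact (Finsupp.mem_span_range_iff_exists_finsupp (R := k)).mp this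
  · exact Submodule.subset_span ⟨0, by simp [Z, orderedMonomial_zero]⟩
  · intro i w hw
    have := hmul (Pi.single i 1) w hw
    simp only [Z, orderedMonomial_single, zpow_one] at this
    exact this
  · intro i w hw
    have := hmul (Pi.single i (-1)) w hw
    simp only [Z, orderedMonomial_single, zpow_neg_one] at this
    exact this

include hΛ he in
/-- The quantum torus embeds into every division ring containing `S_{n,r}^Λ(k)`. -/
theorem exists_injective_quantumTorus :
    ∃ g : QuantumTorus k Λ →ₐ[k] D, Function.Injective g := by
  obtain ⟨κ, ψ, Y, hκ, hψκ, hY, hψ⟩ := exists_factorization_through_crossed hΛ hr e he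
  obtain ⟨g, hg⟩ := QuantumTorus.exists_lift Y hY
  refine ⟨g, (injective_iff_map_eq_zero g).mpr fun z hz => ?_⟩
  obtain ⟨c, rfl⟩ := QuantumTorus.exists_linearCombination hΛ z
  have hgY (a : Fin n → ℤ) :
      g ((orderedMonomial (QuantumTorus.yUnit Λ) a : (QuantumTorus k Λ)ˣ) : QuantumTorus k Λ) =
        ψ ((torusCrossedData hΛ hr).single a 1) := by
    have h1 : Units.map (g : QuantumTorus k Λ →* D) (orderedMonomial (QuantumTorus.yUnit Λ) a) =
        orderedMonomial Y a := by
      rw [map_orderedMonomial]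
      congr 1
      ext i
      exact hg i
    rw [hψ, ← h1]
    rfl
  have hgψ : g (Finsupp.linearCombination k (fun a =>
      ((orderedMonomial (QuantumTorus.yUnit Λ) a : (QuantumTorus k Λ)ˣ) : QuantumTorus k Λ)) c) =
      ψ (Finsupp.linearCombination k (fun a => (torusCrossedData hΛ hr).single a 1) c) := by
    simp only [Finsupp.linearCombination_apply, Finsupp.sum, map_sum, map_smul, hgY]
  rw [hgψ] at hz
  obtain ⟨N, s, hs⟩ := (torusCrossedData hΛ hr).exists_single_mul_mem κ.range
    (fun j => ⟨_, hκ j⟩) c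
  have hs0 : s = 0 := by
    apply he
    rw [map_zero, ← hψκ]
    exact (congrArg ψ hs).trans (by rw [map_mul, hz, mul_zero])
  rw [hs0] at hs
  replace hs := (map_zero κ).symm.trans hs
  have h2 := congrArg (fun f => (torusCrossedData hΛ hr).single (-N) 1 * f) hs
  simp only [mul_zero, ← mul_assoc, CrossedData.single_mul_single, neg_add_cancel, map_one,
    mul_one, Units.smul_def, ← CrossedData.smul_single, smul_mul_assoc, ← CrossedData.one_def,
    one_mul] at h2
  have h3 := (smul_eq_zero.mp h2.symm).resolve_left (Units.ne_zero _)
  rw [← map_zero (Finsupp.linearCombination k _)] at h3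
  rw [(torusCrossedData hΛ hr).linearCombination_single_injective h3, map_zero]

include hΛ he in
/-- Quantum tori mapping to the division ring of fractions of `S_{n,r}^Λ(k)` map to `O_Λ`. -/
theorem exists_quantumTorus_to_quantumTorus
    (hfrac : ∀ d : D, ∃ a b, b ≠ 0 ∧ d = e a * (e b)⁻¹)
    {m : ℕ} {M : Matrix (Fin m) (Fin m) k} (hM : M.MulAntisymmetric)
    (g : QuantumTorus k M →ₐ[k] D) : Nonempty (QuantumTorus k M →ₐ[k] QuantumTorus k Λ) := by
  obtain ⟨κ, ψ, -, -, hψκ, -, -⟩ := exists_factorization_through_crossed hΛ hr e he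
  have hκ : Function.Injective κ := fun s t h => he (by rw [← hψκ, ← hψκ, h])
  have hκ0 {s} (hs : s ≠ 0) : κ s ≠ 0 := (map_ne_zero_iff κ hκ).mpr hs
  obtain ⟨V, hV, hVc⟩ := exists_value hΛ hr
  obtain ⟨w, hw, hwe⟩ := exists_extend_to_fractions (e : _ →+* D) he hfrac (fun s => V (κ s))
    (fun s t hs ht => by rw [map_mul, hV _ _ (hκ0 hs) (hκ0 ht)])
  have hwc (c : k) (hc : c ≠ 0) :
      (w (algebraMap k D c) : QuantumTorus k Λ) = algebraMap k _ c := by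
    have h0 : algebraMap k (MixedCrossedAlgebra k Λ r hr) c ≠ 0 := by
      rw [← map_ne_zero_iff e he, e.commutes]
      simpa using hc
    have h1 := hwe _ h0
    rw [κ.commutes] at h1
    rw [← hVc c hc, ← h1]
    congr 2
    exact (e.commutes c).symm
  have hd (i : Fin m) : g (QuantumTorus.y k M i) ≠ 0 := by
    intro h0
    have := congrArg g (QuantumTorus.y_mul_yinv (Λ := M) i)
    rw [map_mul, h0, zero_mul, map_one] at this
    exact zero_ne_one this
  obtain ⟨f, -⟩ := QuantumTorus.exists_lift (Λ := M) (fun i => w (g (QuantumTorus.y k M i)))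
    (fun i j => by
      have hM0 : M i j ≠ 0 := left_ne_zero_of_mul_eq_one (hM.2 i j)
      have hMD : algebraMap k D (M i j) ≠ 0 := by simpa using hM0
      have h1 := congrArg (fun z => w (g z)) (QuantumTorus.y_mul_y (Λ := M) i j)
      simp only [map_mul, g.commutes] at h1
      rw [hw _ _ (hd i) (hd j), hw _ _ hMD (mul_ne_zero (hd j) (hd i)), hw _ _ (hd j) (hd i)] at h1
      rw [← hwc _ hM0]
      exact congrArg Units.val h1)
  exact ⟨f⟩

end Fractions

/-- The quantum torus `O_Λ((k*)^n)` is a maximal quantum subtorus of any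
division ring of fractions of `S_{n,r}^Λ(k)`. -/
theorem stmt12 {k : Type u} [Field k] [CharZero k] {n : ℕ} (hn : 1 ≤ n) {r : ℕ} (hr : r ≤ n)
    (Λ : Matrix (Fin n) (Fin n) k) (hΛ : Λ.MulAntisymmetric)
    (F : FractionDivisionRing k (MixedCrossedAlgebra k Λ r hr)) :
    IsMaxQuantumSubtorus k Λ F.carrier := by
  obtain ⟨g, hg⟩ := exists_injective_quantumTorus hΛ hr F.emb F.emb_injective
  exact ⟨⟨g, hg⟩, fun m _ M hM ⟨f⟩ =>
    exists_quantumTorus_to_quantumTorus hΛ hr F.emb F.emb_injective F.frac hM f⟩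
end

section
/- Let m, n, t ∈ ℕ and q̄ = (q_1,…,q_n) with each q_k ∈ k∖{0,1}. Let (D, ι) be a division ring of fractions of A_{m,n,t}^{q̄}(k). Then: (1) there exist a division ring of fractions (E, j) of the Weyl algebra A_m(k) and an injective k-algebra homomorphism E → D; and (2) for every m' ∈ ℕ, if there exist a division ring of fractions (E', j') of the Weyl algebra A_{m'}(k) and an injective k-algebra homomorphism E' → D, then m' ≤ m. (Equivalently, the w-lower degree of the mixed Weyl skew field D_{m,n,t}^{q̄}(k) equals 2m.) -/
universe u

inductive MWGen (m n t : ℕ) : Type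
  | x : Fin m → MWGen m n t
  | y : Fin m → MWGen m n t
  | u : Fin n → MWGen m n t
  | v : Fin n → MWGen m n t
  | z : Fin t → MWGen m n t

/-- The pairs of generators of `A_{m,n,t}^{q̄}(k)` satisfying a non-trivial relation. -/
def MWGen.IsSpecialPair {m n t : ℕ} : MWGen m n t → MWGen m n t → Prop
  | .x i, .y j => i = j
  | .y i, .x j => i = j
  | .u i, .v j => i = j
  | .v i, .u j => i = j
  | _, _ => False

/-- Defining relations of the algebra `A_{m,n,t}^{q̄}(k)`. -/
inductive MWRel (k : Type u) [Field k] (m n t : ℕ) (q : Fin n → k) :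
    FreeAlgebra k (MWGen m n t) → FreeAlgebra k (MWGen m n t) → Prop
  | weyl (i : Fin m) :
      MWRel k m n t q (FreeAlgebra.ι k (MWGen.x i) * FreeAlgebra.ι k (MWGen.y i))
        (FreeAlgebra.ι k (MWGen.y i) * FreeAlgebra.ι k (MWGen.x i) + 1)
  | quantum (i : Fin n) :
      MWRel k m n t q (FreeAlgebra.ι k (MWGen.u i) * FreeAlgebra.ι k (MWGen.v i))
        (algebraMap k _ (q i) * (FreeAlgebra.ι k (MWGen.v i) * FreeAlgebra.ι k (MWGen.u i)))
  | comm (a b : MWGen m n t) (hab : a ≠ b) (h : ¬ a.IsSpecialPair b) :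
      MWRel k m n t q (FreeAlgebra.ι k a * FreeAlgebra.ι k b)
        (FreeAlgebra.ι k b * FreeAlgebra.ι k a)

/-- The algebra `A_{m,n,t}^{q̄}(k)` (tensor product of a Weyl algebra, quantum planes and
a commutative polynomial algebra), whose fraction division ring is the mixed Weyl
skew field `D_{m,n,t}^{q̄}(k)`. -/
def MixedWeylAlgebra (k : Type u) [Field k] (m n t : ℕ) (q : Fin n → k) :=
  RingQuot (MWRel k m n t q)

noncomputable instance (k : Type u) [Field k] (m n t : ℕ) (q : Fin n → k) :
    Ring (MixedWeylAlgebra k m n t q) := by unfold MixedWeylAlgebra; infer_instance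

noncomputable instance (k : Type u) [Field k] (m n t : ℕ) (q : Fin n → k) :
    Algebra k (MixedWeylAlgebra k m n t q) := by unfold MixedWeylAlgebra; infer_instance

/-- The Weyl algebra `A_m(k) = A_{m,0,0}(k)`. -/
def WeylAlgebra (k : Type u) [Field k] (m : ℕ) := MixedWeylAlgebra k m 0 0 Fin.elim0

noncomputable instance (k : Type u) [Field k] (m : ℕ) : Ring (WeylAlgebra k m) := by
  unfold WeylAlgebra; infer_instance

noncomputable instance (k : Type u) [Field k] (m : ℕ) : Algebra k (WeylAlgebra k m) := by
  unfold WeylAlgebra; infer_instance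

namespace Finsupp

theorem induction_add_single_one {ι : Type*} {p : (ι →₀ ℕ) → Prop} (h0 : p 0)
    (h1 : ∀ e a, p e → p (e + single a 1)) (e : ι →₀ ℕ) : p e := by
  induction e using Finsupp.induction with
  | zero => exact h0
  | single_add a b f _ _ ih =>
    rw [add_comm]
    clear * - ih h1
    induction b with
    | zero => simpa using ih
    | succ b hb =>
      rw [single_add, ← add_assoc]
      exact h1 _ _ hb

end Finsupp

namespace MWGen

variable {m n t : ℕ}

/-- The generators as a disjoint union. -/
def equivSum : MWGen m n t ≃ Fin m ⊕ Fin m ⊕ Fin n ⊕ Fin n ⊕ Fin t where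
  toFun
    | .x i => .inl i
    | .y i => .inr (.inl i)
    | .u i => .inr (.inr (.inl i))
    | .v i => .inr (.inr (.inr (.inl i)))
    | .z i => .inr (.inr (.inr (.inr i)))
  invFun
    | .inl i => .x i
    | .inr (.inl i) => .y i
    | .inr (.inr (.inl i)) => .u i
    | .inr (.inr (.inr (.inl i))) => .v i
    | .inr (.inr (.inr (.inr i))) => .z i
  left_inv a := by cases a <;> rfl
  right_inv a := by rcases a with a | a | a | a | a <;> rfl

noncomputable instance : Fintype (MWGen m n t) := Fintype.ofEquiv _ equivSum.symm

noncomputable instance : DecidableEq (MWGen m n t) := Classical.decEq _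

/-- The generators acting on polynomials by plain multiplication. -/
def IsPoly : MWGen m n t → Prop
  | .x _ => False
  | .y _ => True
  | .u _ => False
  | .v _ => True
  | .z _ => True

end MWGen

section CommMonomial

variable {ι B : Type*} [Monoid B]

theorem pairwise_commute_powersHom (c : ι → B) (hc : ∀ i j, Commute (c i) (c j)) :
    Pairwise fun i j => ∀ x y, Commute (powersHom B (c i) x) (powersHom B (c j) y) := by
  intro i j _ x y
  simpa [powersHom_apply] using (hc i j).pow_pow _ _

variable [Fintype ι]

/-- The monomial with exponents `e` in a commuting family `c`. -/
noncomputable def commMonomial (c : ι → B) (hc : ∀ i j, Commute (c i) (c j)) (e : ι →₀ ℕ) : B :=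
  MonoidHom.noncommPiCoprod (fun i => powersHom B (c i)) (pairwise_commute_powersHom c hc)
    (fun i => Multiplicative.ofAdd (e i))

variable (c : ι → B) (hc : ∀ i j, Commute (c i) (c j))

theorem commMonomial_zero : commMonomial c hc 0 = 1 :=
  map_one _

theorem commMonomial_add_single (e : ι →₀ ℕ) (i : ι) :
    commMonomial c hc (e + Finsupp.single i 1) = c i * commMonomial c hc e := by
  classical
  have h : (fun j => Multiplicative.ofAdd ((e + Finsupp.single i 1 : ι →₀ ℕ) j)) =
      (Pi.mulSingle i (Multiplicative.ofAdd 1) : ι → Multiplicative ℕ) *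
        fun j => Multiplicative.ofAdd (e j) := by
    ext j
    by_cases hj : j = i
    · subst hj; simp [add_comm]
    · simp [hj]
  unfold commMonomial
  rw [h, map_mul, MonoidHom.noncommPiCoprod_mulSingle]
  simp [powersHom_apply]

end CommMonomial

/-- A family of elements satisfying the defining relations of the mixed Weyl algebra. -/
structure IsMWSystem {R B : Type*} [CommRing R] [Ring B] [Algebra R B] {m n t : ℕ}
    (q : Fin n → R) (g : MWGen m n t → B) : Prop where
  weyl : ∀ i, g (.x i) * g (.y i) = g (.y i) * g (.x i) + 1
  quantum : ∀ i, g (.u i) * g (.v i) = q i • (g (.v i) * g (.u i))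
  comm : ∀ a b, ¬ a.IsSpecialPair b → Commute (g a) (g b)

namespace IsMWSystem

variable {R B : Type*} [CommRing R] [Ring B] [Algebra R B] {m n t : ℕ}
    {q : Fin n → R} {g : MWGen m n t → B}

open scoped Classical in
/-- The generators acting by multiplication, the others being replaced by `1`. -/
noncomputable def low (g : MWGen m n t → B) (a : MWGen m n t) : B := if a.IsPoly then g a else 1

open scoped Classical in
/-- The generators not acting by multiplication, the others being replaced by `1`. -/
noncomputable def high (g : MWGen m n t → B) (a : MWGen m n t) : B := if a.IsPoly then 1 else g a

theorem commute_low (hg : IsMWSystem q g) (a b : MWGen m n t) :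
    Commute (low g a) (low g b) := by
  unfold low
  split_ifs with ha hb
  · refine hg.comm _ _ ?_
    cases a <;> cases b <;> simp_all [MWGen.IsPoly, MWGen.IsSpecialPair]
  all_goals simp

theorem commute_high (hg : IsMWSystem q g) (a b : MWGen m n t) :
    Commute (high g a) (high g b) := by
  unfold high
  split_ifs with ha hb
  · simp
  · simp
  · simp
  · refine hg.comm _ _ ?_
    cases a <;> cases b <;> simp_all [MWGen.IsPoly, MWGen.IsSpecialPair]

/-- The product of the generators acting by multiplication, with exponents `e`. -/
noncomputable def lowMon (hg : IsMWSystem q g) (e : MWGen m n t →₀ ℕ) : B :=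
  commMonomial (low g) hg.commute_low e

/-- The product of the generators not acting by multiplication, with exponents `e`. -/
noncomputable def highMon (hg : IsMWSystem q g) (e : MWGen m n t →₀ ℕ) : B :=
  commMonomial (high g) hg.commute_high e

/-- The ordered monomials. -/
noncomputable def mon (hg : IsMWSystem q g) (e : MWGen m n t →₀ ℕ) : B :=
  hg.lowMon e * hg.highMon e

theorem lowMon_add_single (hg : IsMWSystem q g) (e : MWGen m n t →₀ ℕ) (a : MWGen m n t) :
    hg.lowMon (e + Finsupp.single a 1) = low g a * hg.lowMon e :=
  commMonomial_add_single _ _ _ _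

theorem highMon_add_single (hg : IsMWSystem q g) (e : MWGen m n t →₀ ℕ) (a : MWGen m n t) :
    hg.highMon (e + Finsupp.single a 1) = high g a * hg.highMon e :=
  commMonomial_add_single _ _ _ _

theorem lowMon_zero (hg : IsMWSystem q g) : hg.lowMon 0 = 1 := commMonomial_zero _ _

theorem highMon_zero (hg : IsMWSystem q g) : hg.highMon 0 = 1 := commMonomial_zero _ _

theorem mon_zero (hg : IsMWSystem q g) : hg.mon 0 = 1 := by
  simp [mon, lowMon_zero, highMon_zero]

theorem low_of_isPoly {a : MWGen m n t} (ha : a.IsPoly) : low g a = g a := if_pos ha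
theorem low_of_not_isPoly {a : MWGen m n t} (ha : ¬ a.IsPoly) : low g a = 1 := if_neg ha
theorem high_of_isPoly {a : MWGen m n t} (ha : a.IsPoly) : high g a = 1 := if_pos ha
theorem high_of_not_isPoly {a : MWGen m n t} (ha : ¬ a.IsPoly) : high g a = g a := if_neg ha

theorem mul_mon_of_isPoly (hg : IsMWSystem q g) {a : MWGen m n t} (ha : a.IsPoly)
    (e : MWGen m n t →₀ ℕ) : g a * hg.mon e = hg.mon (e + Finsupp.single a 1) := by
  simp [mon, lowMon_add_single, highMon_add_single, low_of_isPoly ha, high_of_isPoly ha, mul_assoc]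

theorem u_mul_lowMon (hg : IsMWSystem q g) (i : Fin n) (e : MWGen m n t →₀ ℕ) :
    g (.u i) * hg.lowMon e = q i ^ e (.v i) • (hg.lowMon e * g (.u i)) := by
  induction e using Finsupp.induction_add_single_one with
  | h0 => simp [lowMon_zero]
  | h1 e a ih =>
    rw [lowMon_add_single]
    by_cases ha : a = .v i
    · subst ha
      rw [low_of_isPoly (by trivial), ← mul_assoc, hg.quantum, smul_mul_assoc, mul_assoc, ih]
      simp [smul_smul, mul_assoc, pow_succ']
    · have hc : Commute (g (.u i)) (low g a) := by
        unfold low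
        split_ifs
        · refine hg.comm _ _ ?_
          rintro h
          cases a <;> simp_all [MWGen.IsSpecialPair]
        · simp
      rw [← mul_assoc, hc.eq, mul_assoc, ih]
      simp [ha, mul_assoc]

theorem x_mul_lowMon (hg : IsMWSystem q g) (i : Fin m) (e : MWGen m n t →₀ ℕ) :
    g (.x i) * hg.lowMon e = hg.lowMon e * g (.x i) +
      e (.y i) • hg.lowMon (e - Finsupp.single (.y i) 1) := by
  induction e using Finsupp.induction_add_single_one with
  | h0 => simp [lowMon_zero]
  | h1 e a ih =>
    rw [lowMon_add_single]
    by_cases ha : a = .y i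
    · subst ha
      have h1 : (e (.y i)) • (g (.y i) * hg.lowMon (e - Finsupp.single (.y i) 1)) =
          (e (.y i)) • hg.lowMon e := by
        rcases Nat.eq_zero_or_pos (e (.y i)) with h | h
        · simp [h]
        · rw [← low_of_isPoly (g := g) (a := .y i) trivial, ← lowMon_add_single,
            tsub_add_cancel_of_le]
          rw [Finsupp.single_le_iff]
          omega
      rw [low_of_isPoly (by trivial), ← mul_assoc, hg.weyl, add_mul, one_mul, mul_assoc, ih,
        mul_add, mul_smul_comm, h1]
      simp [add_smul, mul_assoc, add_assoc]
    · have hc : Commute (g (.x i)) (low g a) := by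
        unfold low
        split_ifs
        · refine hg.comm _ _ ?_
          rintro h
          cases a <;> simp_all [MWGen.IsSpecialPair]
        · simp
      rw [← mul_assoc, hc.eq, mul_assoc, ih, mul_add, mul_smul_comm, ← lowMon_add_single,
        mul_assoc]
      have h2 : e - Finsupp.single (.y i) 1 + Finsupp.single a 1 =
          e + Finsupp.single a 1 - Finsupp.single (.y i) 1 := by
        ext b
        simp only [Finsupp.coe_add, Finsupp.coe_tsub, Pi.add_apply, Pi.sub_apply,
          Finsupp.single_apply]
        split_ifs with h3 h4
        · exact absurd (h4.trans h3.symm) ha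
        all_goals omega
      rw [h2]
      simp [ha]

theorem u_mul_mon (hg : IsMWSystem q g) (i : Fin n) (e : MWGen m n t →₀ ℕ) :
    g (.u i) * hg.mon e = q i ^ e (.v i) • hg.mon (e + Finsupp.single (.u i) 1) := by
  have hu : ¬ (MWGen.u i : MWGen m n t).IsPoly := id
  rw [mon, ← mul_assoc, u_mul_lowMon, mon, lowMon_add_single, highMon_add_single,
    low_of_not_isPoly hu, high_of_not_isPoly hu]
  simp [mul_assoc]

theorem x_mul_mon (hg : IsMWSystem q g) (i : Fin m) (e : MWGen m n t →₀ ℕ) :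
    g (.x i) * hg.mon e = hg.mon (e + Finsupp.single (.x i) 1) +
      e (.y i) • hg.mon (e - Finsupp.single (.y i) 1) := by
  have hu : ¬ (MWGen.x i : MWGen m n t).IsPoly := id
  have h1 : (e (.y i)) • (hg.lowMon (e - Finsupp.single (.y i) 1) * hg.highMon e) =
      (e (.y i)) • hg.mon (e - Finsupp.single (.y i) 1) := by
    rcases Nat.eq_zero_or_pos (e (.y i)) with h | h
    · simp [h]
    · have h2 : e = e - Finsupp.single (.y i) 1 + Finsupp.single (.y i) 1 := by
        rw [tsub_add_cancel_of_le]
        rw [Finsupp.single_le_iff]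
        omega
      have h3 : hg.highMon e = hg.highMon (e - Finsupp.single (.y i) 1) := by
        conv_lhs => rw [h2, highMon_add_single, high_of_isPoly (by trivial), one_mul]
      rw [h3, mon]
  have h4 : hg.mon (e + Finsupp.single (.x i) 1) = hg.lowMon e * (g (.x i) * hg.highMon e) := by
    rw [mon, lowMon_add_single, highMon_add_single, low_of_not_isPoly hu, high_of_not_isPoly hu,
      one_mul]
  rw [h4, ← h1, mon, ← mul_assoc, x_mul_lowMon, add_mul, smul_mul_assoc, mul_assoc]

/-- The linear map sending a (commutative) monomial to the corresponding ordered monomial. -/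
noncomputable def ord (hg : IsMWSystem q g) : MvPolynomial (MWGen m n t) R →ₗ[R] B :=
  (MvPolynomial.basisMonomials (MWGen m n t) R).constr R hg.mon

theorem ord_monomial (hg : IsMWSystem q g) (e : MWGen m n t →₀ ℕ) (c : R) :
    hg.ord (MvPolynomial.monomial e c) = c • hg.mon e := by
  have h : MvPolynomial.monomial e c = c • MvPolynomial.basisMonomials (MWGen m n t) R e := by
    simp [MvPolynomial.smul_monomial]
  rw [h, map_smul, ord, Module.Basis.constr_basis]

theorem ord_eq_sum (hg : IsMWSystem q g) (f : MvPolynomial (MWGen m n t) R) :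
    hg.ord f = ∑ e ∈ f.support, f.coeff e • hg.mon e := by
  conv_lhs => rw [f.as_sum, map_sum]
  simp only [ord_monomial]

theorem ord_one (hg : IsMWSystem q g) : hg.ord 1 = 1 := by
  have := hg.ord_monomial 0 1
  rwa [one_smul, mon_zero] at this

theorem map {B' : Type*} [Ring B'] [Algebra R B'] (φ : B →ₐ[R] B') (hg : IsMWSystem q g) :
    IsMWSystem q (fun a => φ (g a)) where
  weyl i := by rw [← map_mul, hg.weyl]; simp
  quantum i := by rw [← map_mul, hg.quantum]; simp
  comm a b h := (hg.comm a b h).map φ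

theorem mem_range_ord_of_mem_adjoin (hg : IsMWSystem q g) {b : B}
    (hb : b ∈ Algebra.adjoin R (Set.range g)) : ∃ f, hg.ord f = b := by
  have key : ∀ a e, g a * hg.mon e ∈ LinearMap.range hg.ord := by
    have hmon : ∀ e, hg.mon e ∈ LinearMap.range hg.ord := fun e => ⟨_, by
      rw [hg.ord_monomial e 1, one_smul]⟩
    intro a e
    by_cases ha : a.IsPoly
    · rw [hg.mul_mon_of_isPoly ha]; exact hmon _
    · cases a with
      | x i => rw [x_mul_mon]; exact add_mem (hmon _) (nsmul_mem (hmon _) _)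
      | u i => rw [u_mul_mon]; exact Submodule.smul_mem _ _ (hmon _)
      | y i => exact absurd trivial ha
      | v i => exact absurd trivial ha
      | z i => exact absurd trivial ha
  have key2 : ∀ b ∈ Algebra.adjoin R (Set.range g), ∀ c ∈ LinearMap.range hg.ord,
      b * c ∈ LinearMap.range hg.ord := by
    intro b hb
    induction hb using Algebra.adjoin_induction with
    | mem b hb =>
      obtain ⟨a, rfl⟩ := hb
      rintro _ ⟨f, rfl⟩
      rw [ord_eq_sum, Finset.mul_sum]
      refine sum_mem fun e _ => ?_
      rw [mul_smul_comm]
      exact Submodule.smul_mem _ _ (key a e)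
    | algebraMap r =>
      intro c hc
      rw [← Algebra.smul_def]
      exact Submodule.smul_mem _ _ hc
    | add x y _ _ hx hy =>
      intro c hc
      rw [add_mul]
      exact add_mem (hx c hc) (hy c hc)
    | mul x y _ _ hx hy =>
      intro c hc
      rw [mul_assoc]
      exact hx _ (hy c hc)
  simpa using key2 b hb 1 ⟨1, hg.ord_one⟩

theorem map_lowMon {B' : Type*} [Ring B'] [Algebra R B'] (φ : B →ₐ[R] B') (hg : IsMWSystem q g)
    (e : MWGen m n t →₀ ℕ) : φ (hg.lowMon e) = (hg.map φ).lowMon e := by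
  induction e using Finsupp.induction_add_single_one with
  | h0 => simp [lowMon_zero]
  | h1 e a ih =>
    rw [lowMon_add_single, lowMon_add_single, map_mul, ih]
    congr 1
    unfold low
    split_ifs <;> simp

theorem map_highMon {B' : Type*} [Ring B'] [Algebra R B'] (φ : B →ₐ[R] B') (hg : IsMWSystem q g)
    (e : MWGen m n t →₀ ℕ) : φ (hg.highMon e) = (hg.map φ).highMon e := by
  induction e using Finsupp.induction_add_single_one with
  | h0 => simp [highMon_zero]
  | h1 e a ih =>
    rw [highMon_add_single, highMon_add_single, map_mul, ih]
    congr 1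
    unfold high
    split_ifs <;> simp

theorem map_ord {B' : Type*} [Ring B'] [Algebra R B'] (φ : B →ₐ[R] B') (hg : IsMWSystem q g)
    (f : MvPolynomial (MWGen m n t) R) : φ (hg.ord f) = (hg.map φ).ord f := by
  simp [ord_eq_sum, mon, map_lowMon φ hg, map_highMon φ hg]

end IsMWSystem

open MvPolynomial in
/-- Rescaling of one variable, as an algebra endomorphism of the polynomial ring. -/
noncomputable def MvPolynomial.rescale {σ R : Type*} [CommRing R] [DecidableEq σ] (s : σ) (r : R) :
    MvPolynomial σ R →ₐ[R] MvPolynomial σ R :=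
  aeval fun a => if a = s then C r * X a else X a

namespace MvPolynomial

variable {σ R : Type*} [CommRing R] [DecidableEq σ]

theorem rescale_X_self (s : σ) (r : R) : rescale s r (X s) = C r * X s := by simp [rescale]

theorem rescale_X_of_ne {s a : σ} (h : a ≠ s) (r : R) : rescale s r (X a) = X a := by
  simp [rescale, h]

theorem rescale_monomial (s : σ) (r : R) (e : σ →₀ ℕ) (c : R) :
    rescale s r (monomial e c) = monomial e (r ^ e s * c) := by
  induction e using Finsupp.induction_add_single_one with
  | h0 =>
    have h : (monomial 0 c : MvPolynomial σ R) = algebraMap _ _ c := rfl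
    simp [h]
  | h1 e a ih =>
    have h (d : R) : (monomial (e + Finsupp.single a 1) d : MvPolynomial σ R) =
        monomial e d * X a := by simp [X, monomial_mul]
    rw [h, map_mul, ih]
    by_cases ha : a = s
    · subst ha
      rw [rescale_X_self, ← mul_assoc, mul_comm _ (C r), C_mul_monomial, ← h]
      simp [pow_succ', mul_assoc]
    · rw [rescale_X_of_ne ha, ← h]
      simp [ha]

theorem coeff_rescale (s : σ) (r : R) (e : σ →₀ ℕ) (f : MvPolynomial σ R) :
    coeff e (rescale s r f) = r ^ e s * coeff e f := by
  induction f using MvPolynomial.induction_on' with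
  | monomial u a =>
    rw [rescale_monomial, coeff_monomial, coeff_monomial]
    split_ifs with h
    · rw [h]
    · simp
  | add p q hp hq => simp [hp, hq, mul_add]

end MvPolynomial

section

open MvPolynomial

section Action

variable {R : Type*} [CommRing R] {m n t : ℕ}

/-- The action of the generators of the mixed Weyl algebra on the polynomial ring. -/
noncomputable def mwAct (q : Fin n → R) (a : MWGen m n t) :
    Module.End R (MvPolynomial (MWGen m n t) R) :=
  match a with
  | .x i => LinearMap.mulLeft R (X (.x i)) + (pderiv (R := R) (.y i)).toLinearMap
  | .u i => LinearMap.mulLeft R (X (.u i)) * (rescale (.v i) (q i)).toLinearMap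
  | b => LinearMap.mulLeft R (X b)

theorem mwAct_x (q : Fin n → R) (i : Fin m) (f : MvPolynomial (MWGen m n t) R) :
    mwAct q (.x i) f = X (.x i) * f + pderiv (.y i) f := rfl

theorem mwAct_u (q : Fin n → R) (i : Fin n) (f : MvPolynomial (MWGen m n t) R) :
    mwAct q (.u i) f = X (.u i) * rescale (.v i) (q i) f := rfl

theorem mwAct_of_isPoly (q : Fin n → R) {a : MWGen m n t} (ha : a.IsPoly) :
    mwAct q a = LinearMap.mulLeft R (X a) := by
  cases a with
  | x i => exact ha.elim
  | u i => exact ha.elim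
  | _ i => rfl

theorem commute_mulLeft_mulLeft (a b : MWGen m n t) :
    Commute (LinearMap.mulLeft R (X a : MvPolynomial (MWGen m n t) R))
      (LinearMap.mulLeft R (X b)) := by
  refine LinearMap.ext fun f => ?_
  simp [mul_left_comm]

theorem commute_pderiv_mulLeft {a b : MWGen m n t} (h : b ≠ a) :
    Commute (pderiv (R := R) a).toLinearMap
      (LinearMap.mulLeft R (X b : MvPolynomial (MWGen m n t) R)) := by
  refine LinearMap.ext fun f => ?_
  simp [pderiv_X_of_ne h]

theorem commute_rescale_mulLeft {a b : MWGen m n t} (h : b ≠ a) (r : R) :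
    Commute (rescale a r).toLinearMap
      (LinearMap.mulLeft R (X b : MvPolynomial (MWGen m n t) R)) := by
  refine LinearMap.ext fun f => ?_
  simp [rescale_X_of_ne h]

theorem commute_pderiv_pderiv (a b : MWGen m n t) :
    Commute (pderiv (R := R) a).toLinearMap (pderiv (R := R) b).toLinearMap := by
  refine LinearMap.ext fun f => MvPolynomial.ext _ _ fun e => ?_
  by_cases h : a = b
  · rw [h]
  · simp [coeff_pderiv, h, Ne.symm h, add_right_comm, mul_right_comm]

theorem commute_rescale_rescale (a b : MWGen m n t) (r s : R) :
    Commute (rescale a r).toLinearMap (rescale b s).toLinearMap := by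
  refine LinearMap.ext fun f => MvPolynomial.ext _ _ fun e => ?_
  simp [coeff_rescale, mul_left_comm]

theorem commute_rescale_pderiv {a b : MWGen m n t} (h : b ≠ a) (r : R) :
    Commute (rescale a r).toLinearMap (pderiv (R := R) b).toLinearMap := by
  refine LinearMap.ext fun f => MvPolynomial.ext _ _ fun e => ?_
  simp [coeff_rescale, coeff_pderiv, h, mul_assoc]

theorem isMWSystem_mwAct (q : Fin n → R) : IsMWSystem q (mwAct (m := m) (t := t) q) where
  weyl i := by
    refine LinearMap.ext fun f => ?_
    simp only [mwAct_of_isPoly q (a := (.y i : MWGen m n t)) trivial, Module.End.mul_apply,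
      LinearMap.mulLeft_apply, mwAct_x, pderiv_mul, pderiv_X_self, LinearMap.add_apply,
      Module.End.one_apply]
    ring
  quantum i := by
    refine LinearMap.ext fun f => ?_
    simp only [mwAct_of_isPoly q (a := (.v i : MWGen m n t)) trivial, Module.End.mul_apply,
      LinearMap.mulLeft_apply, mwAct_u, map_mul, rescale_X_self, LinearMap.smul_apply,
      MvPolynomial.smul_eq_C_mul]
    ring
  comm := by
    have key1 : ∀ (i : Fin m) (b : MWGen m n t), b ≠ .y i → b.IsPoly →
        Commute (mwAct q (.x i)) (mwAct q b) := by
      intro i b hb hp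
      rw [mwAct_of_isPoly q hp]
      exact (commute_mulLeft_mulLeft _ _).add_left (commute_pderiv_mulLeft hb)
    have key2 : ∀ (i : Fin n) (b : MWGen m n t), b ≠ .v i → b.IsPoly →
        Commute (mwAct q (.u i)) (mwAct q b) := by
      intro i b hb hp
      rw [mwAct_of_isPoly q hp]
      exact (commute_mulLeft_mulLeft _ _).mul_left (commute_rescale_mulLeft hb _)
    have key3 : ∀ (i : Fin m) (j : Fin n),
        Commute (mwAct (t := t) q (.x i)) (mwAct q (.u j)) := by
      intro i j
      refine Commute.add_left (Commute.mul_right (commute_mulLeft_mulLeft _ _) ?_)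
        (Commute.mul_right (commute_pderiv_mulLeft (by simp)) ?_)
      · exact (commute_rescale_mulLeft (by simp) _).symm
      · exact (commute_rescale_pderiv (by simp) _).symm
    have key4 : ∀ (i j : Fin m), Commute (mwAct (t := t) q (.x i)) (mwAct q (.x j)) := by
      intro i j
      refine Commute.add_left (Commute.add_right (commute_mulLeft_mulLeft _ _) ?_)
        (Commute.add_right (commute_pderiv_mulLeft (by simp)) ?_)
      · exact (commute_pderiv_mulLeft (by simp)).symm
      · exact commute_pderiv_pderiv _ _
    have key5 : ∀ (i j : Fin n),
        Commute (mwAct (m := m) (t := t) q (.u i)) (mwAct q (.u j)) := by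
      intro i j
      refine Commute.mul_left (Commute.mul_right (commute_mulLeft_mulLeft _ _) ?_)
        (Commute.mul_right (commute_rescale_mulLeft (by simp) _) ?_)
      · exact (commute_rescale_mulLeft (by simp) _).symm
      · exact commute_rescale_rescale _ _ _ _
    have key6 : ∀ a b : MWGen m n t, a.IsPoly → b.IsPoly →
        Commute (mwAct q a) (mwAct q b) := by
      intro a b ha hb
      rw [mwAct_of_isPoly q ha, mwAct_of_isPoly q hb]
      exact commute_mulLeft_mulLeft _ _
    intro a b h
    by_cases ha : a.IsPoly
    · by_cases hb : b.IsPoly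
      · exact key6 a b ha hb
      · cases b with
        | x i =>
          refine (key1 i a ?_ ha).symm
          rintro rfl
          exact h rfl
        | u i =>
          refine (key2 i a ?_ ha).symm
          rintro rfl
          exact h rfl
        | _ i => exact absurd trivial hb
    · cases a with
      | x i =>
        by_cases hb : b.IsPoly
        · refine key1 i b ?_ hb
          rintro rfl
          exact h rfl
        · cases b with
          | x j => exact key4 i j
          | u j => exact key3 i j
          | _ i => exact absurd trivial hb
      | u i =>
        by_cases hb : b.IsPoly
        · refine key2 i b ?_ hb
          rintro rfl
          exact h rfl
        · cases b with
          | x j => exact (key3 j i).symm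
          | u j => exact key5 i j
          | _ i => exact absurd trivial hb
      | _ i => exact absurd trivial ha

/-- The normally ordered operator with a given symbol. -/
noncomputable def mwOp (q : Fin n → R) :
    MvPolynomial (MWGen m n t) R →ₗ[R] Module.End R (MvPolynomial (MWGen m n t) R) :=
  (isMWSystem_mwAct q).ord

open scoped Classical in
theorem lowMon_mwAct_apply (q : Fin n → R) (e b : MWGen m n t →₀ ℕ) :
    (isMWSystem_mwAct q).lowMon e (monomial b 1) =
      monomial (e.filter MWGen.IsPoly + b) 1 := by
  induction e using Finsupp.induction_add_single_one with
  | h0 => simp [IsMWSystem.lowMon_zero, Finsupp.filter_zero]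
  | h1 e a ih =>
    rw [IsMWSystem.lowMon_add_single, Finsupp.filter_add, Module.End.mul_apply, ih]
    by_cases ha : a.IsPoly
    · rw [IsMWSystem.low_of_isPoly ha, mwAct_of_isPoly q ha, LinearMap.mulLeft_apply, X,
        monomial_mul, one_mul, Finsupp.filter_single_of_pos MWGen.IsPoly ha]
      congr 2
      abel
    · rw [IsMWSystem.low_of_not_isPoly ha, Finsupp.filter_single_of_neg MWGen.IsPoly ha]
      simp

open scoped Classical in
theorem highMon_mwAct_apply (q : Fin n → R) (e : MWGen m n t →₀ ℕ) :
    (isMWSystem_mwAct q).highMon e 1 = monomial (e.filter fun a => ¬ a.IsPoly) 1 := by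
  induction e using Finsupp.induction_add_single_one with
  | h0 => rw [IsMWSystem.highMon_zero, Finsupp.filter_zero]; rfl
  | h1 e a ih =>
    have hz : ∀ c : MWGen m n t, c.IsPoly → (e.filter fun a => ¬ a.IsPoly) c = 0 := fun c hc =>
      Finsupp.filter_apply_neg (fun a => ¬ MWGen.IsPoly a) e (not_not.mpr hc)
    rw [IsMWSystem.highMon_add_single, Finsupp.filter_add, Module.End.mul_apply, ih]
    by_cases ha : a.IsPoly
    · rw [IsMWSystem.high_of_isPoly ha,
        Finsupp.filter_single_of_neg (fun a => ¬ MWGen.IsPoly a) (not_not.mpr ha)]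
      simp
    · rw [IsMWSystem.high_of_not_isPoly ha,
        Finsupp.filter_single_of_pos (fun a => ¬ MWGen.IsPoly a) ha]
      cases a with
      | x i =>
        rw [mwAct_x, pderiv_monomial, hz (.y i) trivial, X, monomial_mul, add_comm]
        simp [add_comm]
      | u i =>
        rw [mwAct_u, rescale_monomial, hz (.v i) trivial, X, monomial_mul, add_comm]
        simp
      | _ i => exact absurd trivial ha

theorem mon_mwAct_apply_one (q : Fin n → R) (e : MWGen m n t →₀ ℕ) :
    (isMWSystem_mwAct q).mon e 1 = monomial e 1 := by
  classical
  rw [IsMWSystem.mon, Module.End.mul_apply, highMon_mwAct_apply, lowMon_mwAct_apply,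
    Finsupp.filter_add_filter_not]

theorem mwOp_apply_one (q : Fin n → R) (f : MvPolynomial (MWGen m n t) R) : mwOp q f 1 = f := by
  rw [mwOp, IsMWSystem.ord_eq_sum]
  conv_rhs => rw [f.as_sum]
  simp [LinearMap.sum_apply, mon_mwAct_apply_one, smul_monomial]

variable {S : Type*} [CommRing S]

theorem map_mwAct (φ : R →+* S) (q : Fin n → R) (a : MWGen m n t)
    (f : MvPolynomial (MWGen m n t) R) :
    map φ (mwAct q a f) = mwAct (φ ∘ q) a (map φ f) := by
  cases a with
  | x i => simp [mwAct_x, pderiv_map]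
  | u i =>
    rw [mwAct_u, mwAct_u, map_mul, map_X]
    congr 1
    ext e
    simp [coeff_map, coeff_rescale]
  | _ i => exact map_mul _ _ _ |>.trans (by rw [map_X]; rfl)

theorem map_lowMon_mwAct (φ : R →+* S) (q : Fin n → R) (e : MWGen m n t →₀ ℕ)
    (f : MvPolynomial (MWGen m n t) R) :
    map φ ((isMWSystem_mwAct q).lowMon e f) =
      (isMWSystem_mwAct (φ ∘ q)).lowMon e (map φ f) := by
  induction e using Finsupp.induction_add_single_one with
  | h0 => simp [IsMWSystem.lowMon_zero]
  | h1 e a ih =>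
    simp only [IsMWSystem.lowMon_add_single, Module.End.mul_apply, ← ih, IsMWSystem.low]
    split_ifs
    · exact map_mwAct _ _ _ _
    · simp

theorem map_highMon_mwAct (φ : R →+* S) (q : Fin n → R) (e : MWGen m n t →₀ ℕ)
    (f : MvPolynomial (MWGen m n t) R) :
    map φ ((isMWSystem_mwAct q).highMon e f) =
      (isMWSystem_mwAct (φ ∘ q)).highMon e (map φ f) := by
  induction e using Finsupp.induction_add_single_one with
  | h0 => simp [IsMWSystem.highMon_zero]
  | h1 e a ih =>
    simp only [IsMWSystem.highMon_add_single, Module.End.mul_apply, ← ih, IsMWSystem.high]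
    split_ifs
    · simp
    · exact map_mwAct _ _ _ _

theorem map_mwOp (φ : R →+* S) (q : Fin n → R) (f g : MvPolynomial (MWGen m n t) R) :
    map φ (mwOp q f g) = mwOp (φ ∘ q) (map φ f) (map φ g) := by
  induction f using MvPolynomial.induction_on' with
  | monomial e c =>
    simp [mwOp, IsMWSystem.ord_monomial, IsMWSystem.mon, map_lowMon_mwAct, map_highMon_mwAct,
      MvPolynomial.smul_eq_C_mul]
  | add p q hp hq => simp [hp, hq]

end Action

section Degree

variable {R : Type*} [CommRing R] {m n t : ℕ}

/-- Some monomial order on the generators. -/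
noncomputable def mwOrder (m n t : ℕ) : MonomialOrder (MWGen m n t) :=
  letI := LinearOrder.lift' (Fintype.equivFin (MWGen m n t)) (Equiv.injective _)
  MonomialOrder.lex

/-- The operator `T` shifts the degree of all nonzero polynomials by `d`. -/
def ShiftsDegree (T : Module.End R (MvPolynomial (MWGen m n t) R)) (d : MWGen m n t →₀ ℕ) : Prop :=
  ∀ f ≠ 0, T f ≠ 0 ∧ (mwOrder m n t).degree (T f) = d + (mwOrder m n t).degree f

theorem ShiftsDegree.mul {T T' : Module.End R (MvPolynomial (MWGen m n t) R)}
    {d d' : MWGen m n t →₀ ℕ} (h : ShiftsDegree T d) (h' : ShiftsDegree T' d') :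
    ShiftsDegree (T * T') (d + d') := fun f hf => by
  obtain ⟨h1, h2⟩ := h' f hf
  obtain ⟨h3, h4⟩ := h _ h1
  exact ⟨h3, by rw [Module.End.mul_apply, h4, h2, add_assoc]⟩

theorem shiftsDegree_one :
    ShiftsDegree (1 : Module.End R (MvPolynomial (MWGen m n t) R)) 0 := fun f hf => by simp [hf]

variable [IsDomain R]

theorem shiftsDegree_mulLeft_X (a : MWGen m n t) :
    ShiftsDegree (LinearMap.mulLeft R (X a : MvPolynomial (MWGen m n t) R))
      (Finsupp.single a 1) := fun f hf => by
  refine ⟨mul_ne_zero (X_ne_zero _) hf, ?_⟩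
  rw [LinearMap.mulLeft_apply, MonomialOrder.degree_mul (X_ne_zero _) hf, MonomialOrder.degree_X]

theorem shiftsDegree_rescale (a : MWGen m n t) {r : R} (hr : r ≠ 0) :
    ShiftsDegree (rescale a r).toLinearMap 0 := fun f hf => by
  have h : (rescale a r f).support = f.support := by
    ext e
    simp [coeff_rescale, hr]
  have h0 : rescale a r f ≠ 0 := by
    rw [← support_nonempty, h, support_nonempty]
    exact hf
  refine ⟨h0, ?_⟩
  simp only [AlgHom.toLinearMap_apply, zero_add]
  simp [MonomialOrder.degree, h]

theorem shiftsDegree_mwAct {q : Fin n → R} (hq : ∀ i, q i ≠ 0) (a : MWGen m n t) :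
    ShiftsDegree (mwAct q a) (Finsupp.single a 1) := by
  cases a with
  | x i =>
    intro f hf
    have h1 := shiftsDegree_mulLeft_X (R := R) (MWGen.x i : MWGen m n t) f hf
    rw [LinearMap.mulLeft_apply] at h1
    have h2 : (mwOrder m n t).toSyn ((mwOrder m n t).degree (pderiv (.y i) f)) <
        (mwOrder m n t).toSyn ((mwOrder m n t).degree (X (.x i) * f)) := by
      rw [h1.2, map_add]
      refine lt_of_le_of_lt (b := (mwOrder m n t).toSyn ((mwOrder m n t).degree f)) ?_ ?_
      · rw [MonomialOrder.degree_le_iff]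
        intro c hc
        have hc' : c + Finsupp.single (.y i) 1 ∈ f.support := by
          rw [mem_support_iff] at hc ⊢
          intro h
          apply hc
          rw [coeff_pderiv, h, zero_mul]
        exact ((mwOrder m n t).toSyn_monotone le_self_add).trans
          (MonomialOrder.le_degree hc')
      · refine lt_add_of_pos_left _ ?_
        rw [MonomialOrder.toSyn_lt_iff_ne_zero]
        simp
    rw [mwAct_x]
    have h3 := MonomialOrder.degree_add_of_lt h2
    refine ⟨?_, h3.trans h1.2⟩
    intro h0
    rw [h0, h1.2] at h3
    have := DFunLike.congr_fun h3 (.x i)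
    simp at this
    lia
  | u i =>
    have := (shiftsDegree_mulLeft_X (R := R) (MWGen.u i : MWGen m n t)).mul
      (shiftsDegree_rescale (.v i) (hq i))
    rwa [add_zero] at this
  | _ i => exact shiftsDegree_mulLeft_X _

theorem shiftsDegree_mon {q : Fin n → R} (hq : ∀ i, q i ≠ 0) (e : MWGen m n t →₀ ℕ) :
    ShiftsDegree ((isMWSystem_mwAct q).mon e) e := by
  classical
  rw [← Finsupp.filter_add_filter_not e MWGen.IsPoly]
  have hlow : ∀ e, ShiftsDegree ((isMWSystem_mwAct (m := m) (t := t) q).lowMon e)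
      (e.filter MWGen.IsPoly) := by
    intro e
    induction e using Finsupp.induction_add_single_one with
    | h0 => simpa [IsMWSystem.lowMon_zero, Finsupp.filter_zero] using shiftsDegree_one
    | h1 e a ih =>
      rw [IsMWSystem.lowMon_add_single, Finsupp.filter_add, add_comm]
      by_cases ha : a.IsPoly
      · rw [IsMWSystem.low_of_isPoly ha, Finsupp.filter_single_of_pos MWGen.IsPoly ha]
        exact (shiftsDegree_mwAct hq a).mul ih
      · rw [IsMWSystem.low_of_not_isPoly ha, Finsupp.filter_single_of_neg MWGen.IsPoly ha]
        simpa using ih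
  have hhigh : ∀ e, ShiftsDegree ((isMWSystem_mwAct (m := m) (t := t) q).highMon e)
      (e.filter fun a => ¬ a.IsPoly) := by
    intro e
    induction e using Finsupp.induction_add_single_one with
    | h0 =>
      rw [IsMWSystem.highMon_zero, Finsupp.filter_zero]
      exact shiftsDegree_one
    | h1 e a ih =>
      rw [IsMWSystem.highMon_add_single, Finsupp.filter_add, add_comm]
      by_cases ha : a.IsPoly
      · rw [IsMWSystem.high_of_isPoly ha,
          Finsupp.filter_single_of_neg (fun a => ¬ MWGen.IsPoly a) (not_not.mpr ha)]
        simpa using ih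
      · rw [IsMWSystem.high_of_not_isPoly ha,
          Finsupp.filter_single_of_pos (fun a => ¬ MWGen.IsPoly a) ha]
        exact (shiftsDegree_mwAct hq a).mul ih
  have := (hlow e).mul (hhigh e)
  rw [Finsupp.filter_add_filter_not] at this ⊢
  exact this

theorem mwOp_injective {q : Fin n → R} (hq : ∀ i, q i ≠ 0) {f : MvPolynomial (MWGen m n t) R}
    (hf : f ≠ 0) : Function.Injective (mwOp q f) := by
  rw [injective_iff_map_eq_zero]
  intro g h0
  by_contra hg
  have h1 : coeff ((mwOrder m n t).degree f + (mwOrder m n t).degree g) (mwOp q f g) =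
      coeff ((mwOrder m n t).degree f) f *
        coeff ((mwOrder m n t).degree f + (mwOrder m n t).degree g)
          ((isMWSystem_mwAct q).mon ((mwOrder m n t).degree f) g) := by
    rw [mwOp, IsMWSystem.ord_eq_sum, LinearMap.sum_apply, coeff_sum,
      Finset.sum_eq_single ((mwOrder m n t).degree f)]
    · simp
    · intro e he hne
      rw [LinearMap.smul_apply, coeff_smul, smul_eq_mul]
      refine mul_eq_zero_of_right _ (MonomialOrder.coeff_eq_zero_of_lt (m := mwOrder m n t) ?_)
      rw [(shiftsDegree_mon hq e g hg).2, map_add, map_add]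
      refine add_lt_add_left (lt_of_le_of_ne (MonomialOrder.le_degree he) ?_) _
      exact fun h => hne ((mwOrder m n t).toSyn.injective h)
    · intro h
      exact absurd (MonomialOrder.degree_mem_support hf) h
  rw [h0, coeff_zero] at h1
  have h2 := shiftsDegree_mon hq ((mwOrder m n t).degree f) g hg
  refine mul_ne_zero ?_ ?_ h1.symm
  · exact MonomialOrder.coeff_degree_ne_zero_iff.mpr hf
  · rw [← h2.2]
    exact MonomialOrder.coeff_degree_ne_zero_iff.mpr h2.1

end Degree

namespace MixedWeylAlgebra

universe w

variable {k : Type u} [Field k] {m n t : ℕ} {q : Fin n → k}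

/-- The quotient map from the free algebra. -/
noncomputable def mk (k : Type u) [Field k] (m n t : ℕ) (q : Fin n → k) :
    FreeAlgebra k (MWGen m n t) →ₐ[k] MixedWeylAlgebra k m n t q :=
  RingQuot.mkAlgHom k (MWRel k m n t q)

/-- The generators of the mixed Weyl algebra. -/
noncomputable def gen (k : Type u) [Field k] (m n t : ℕ) (q : Fin n → k) (a : MWGen m n t) :
    MixedWeylAlgebra k m n t q := mk k m n t q (FreeAlgebra.ι k a)

theorem mk_rel {a b : FreeAlgebra k (MWGen m n t)} (h : MWRel k m n t q a b) :
    mk k m n t q a = mk k m n t q b := RingQuot.mkAlgHom_rel k h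

theorem mk_surjective : Function.Surjective (mk k m n t q) :=
  RingQuot.mkAlgHom_surjective k _

theorem isMWSystem_gen : IsMWSystem q (gen k m n t q) where
  weyl i := by simpa [gen] using mk_rel (q := q) (MWRel.weyl (n := n) (t := t) i)
  quantum i := by
    simpa [gen, Algebra.smul_def] using mk_rel (q := q) (MWRel.quantum (m := m) (t := t) i)
  comm a b h := by
    by_cases hab : a = b
    · subst hab; exact Commute.refl _
    · simpa [gen, Commute, SemiconjBy] using mk_rel (q := q) (MWRel.comm a b hab h)

theorem adjoin_range_gen : Algebra.adjoin k (Set.range (gen k m n t q)) = ⊤ := by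
  have h : Set.range (gen k m n t q) = mk k m n t q '' Set.range (FreeAlgebra.ι k) := by
    rw [← Set.range_comp]; rfl
  rw [h, ← AlgHom.map_adjoin, FreeAlgebra.adjoin_range_ι, Algebra.map_top,
    AlgHom.range_eq_top]
  exact mk_surjective

theorem ord_surjective : Function.Surjective (isMWSystem_gen (q := q) (m := m) (t := t)).ord :=
  fun b => isMWSystem_gen.mem_range_ord_of_mem_adjoin (by rw [adjoin_range_gen]; trivial)

/-- The algebra map defined by a system satisfying the defining relations. -/
noncomputable def lift {B : Type w} [Ring B] [Algebra k B] {g : MWGen m n t → B}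
    (hg : IsMWSystem q g) : MixedWeylAlgebra k m n t q →ₐ[k] B :=
  RingQuot.liftAlgHom k ⟨FreeAlgebra.lift k g, by
    intro a b h
    induction h with
    | weyl i => simpa using hg.weyl i
    | quantum i => simpa [Algebra.smul_def] using hg.quantum i
    | comm a b hab h => simpa using (hg.comm a b h).eq⟩

theorem lift_gen {B : Type w} [Ring B] [Algebra k B] {g : MWGen m n t → B}
    (hg : IsMWSystem q g) (a : MWGen m n t) : lift hg (gen k m n t q a) = g a := by
  refine (RingQuot.liftAlgHom_mkAlgHom_apply _ _ _ _).trans ?_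
  simp

/-- The action on the polynomial ring. -/
noncomputable def act (k : Type u) [Field k] (m n t : ℕ) (q : Fin n → k) :
    MixedWeylAlgebra k m n t q →ₐ[k] Module.End k (MvPolynomial (MWGen m n t) k) :=
  lift (isMWSystem_mwAct q)

theorem act_gen (a : MWGen m n t) : act k m n t q (gen k m n t q a) = mwAct q a := lift_gen _ _

theorem act_ord (f : MvPolynomial (MWGen m n t) k) :
    act k m n t q (isMWSystem_gen.ord f) = mwOp q f := by
  rw [IsMWSystem.map_ord]
  simp only [act_gen, mwOp]

theorem act_ord_one (f : MvPolynomial (MWGen m n t) k) :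
    act k m n t q (isMWSystem_gen.ord f) 1 = f := by
  rw [act_ord, mwOp_apply_one]

theorem act_apply_one_injective :
    Function.Injective fun a : MixedWeylAlgebra k m n t q => act k m n t q a 1 := by
  intro a b h
  obtain ⟨f, rfl⟩ := ord_surjective a
  obtain ⟨f', rfl⟩ := ord_surjective b
  simp only [act_ord_one] at h
  rw [h]

end MixedWeylAlgebra

section RightFractions

variable {k : Type u} [Field k] {W : Type u} [Ring W] [Algebra k W] {D : Type u} [DivisionRing D]
  [Algebra k D]

/-- The right fractions of a subring satisfying the right Ore condition form a subfield. -/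
def rightFractions (φ : W →ₐ[k] D) (hφ : Function.Injective φ)
    (ore : ∀ a b : W, b ≠ 0 → ∃ c e : W, e ≠ 0 ∧ a * e = b * c) : Subfield D :=
  have h0 : ∀ {a : W}, a ≠ 0 → φ a ≠ 0 := fun ha h => ha (hφ (h.trans (map_zero φ).symm))
  { carrier := {d | ∃ a b : W, b ≠ 0 ∧ d = φ a * (φ b)⁻¹}
    zero_mem' := ⟨0, 1, fun h => by simpa using congrArg φ h, by simp⟩
    one_mem' := ⟨1, 1, fun h => by simpa using congrArg φ h, by simp⟩
    neg_mem' := by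
      rintro _ ⟨a, b, hb, rfl⟩
      exact ⟨-a, b, hb, by simp⟩
    inv_mem' := by
      rintro _ ⟨a, b, hb, rfl⟩
      by_cases ha : a = 0
      · exact ⟨0, b, hb, by simp [ha]⟩
      · exact ⟨b, a, ha, by simp⟩
    mul_mem' := by
      rintro _ _ ⟨a, b, hb, rfl⟩ ⟨c, d, hd, rfl⟩
      obtain ⟨f, e, he, h⟩ := ore c b hb
      have h1 : φ c * φ e = φ b * φ f := by rw [← map_mul, h, map_mul]
      have h2 : (φ b)⁻¹ * φ c = φ f * (φ e)⁻¹ := by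
        rw [eq_mul_inv_iff_mul_eq₀ (h0 he), mul_assoc, h1, inv_mul_cancel_left₀ (h0 hb)]
      refine ⟨a * f, d * e, ?_, ?_⟩
      · intro h
        have := congrArg φ h
        rw [map_mul, map_zero, mul_eq_zero] at this
        exact this.elim (h0 hd) (h0 he)
      · rw [map_mul, map_mul, mul_inv_rev, mul_assoc, ← mul_assoc (φ b)⁻¹, h2]
        simp only [mul_assoc]
    add_mem' := by
      rintro _ _ ⟨a, b, hb, rfl⟩ ⟨c, d, hd, rfl⟩
      obtain ⟨f, e, he, h⟩ := ore b d hd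
      have h1 : φ b * φ e = φ d * φ f := by rw [← map_mul, h, map_mul]
      have h2 : φ (b * e) ≠ 0 := by
        rw [map_mul]
        exact mul_ne_zero (h0 hb) (h0 he)
      refine ⟨a * e + c * f, b * e, fun h => h2 (by rw [h, map_zero]), ?_⟩
      rw [eq_mul_inv_iff_mul_eq₀ h2, add_mul, map_add, map_mul, map_mul, map_mul]
      congr 1
      · rw [mul_assoc, inv_mul_cancel_left₀ (h0 hb)]
      · rw [h1, mul_assoc, inv_mul_cancel_left₀ (h0 hd)] }

theorem exists_fractionDivisionRing_of_ore (φ : W →ₐ[k] D) (hφ : Function.Injective φ)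
    (ore : ∀ a b : W, b ≠ 0 → ∃ c e : W, e ≠ 0 ∧ a * e = b * c) :
    ∃ (E : FractionDivisionRing k W) (g : E.carrier →ₐ[k] D), Function.Injective g := by
  let S := rightFractions φ hφ ore
  have hmem : ∀ a, φ a ∈ S := fun a =>
    ⟨a, 1, fun h => by simpa using congrArg φ h, by simp⟩
  have hk : ∀ r, algebraMap k D r ∈ S := fun r => by
    rw [← φ.commutes]
    exact hmem _
  let _ : Algebra k S := RingHom.toAlgebra' ((algebraMap k D).codRestrict S hk) fun r x =>
    Subtype.ext (Algebra.commutes r (x : D))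
  let emb : W →ₐ[k] S :=
    { (φ : W →+* D).codRestrict S hmem with
      commutes' := fun r => Subtype.ext (φ.commutes r) }
  have hemb : ∀ a, (emb a : D) = φ a := fun _ => rfl
  refine ⟨⟨S, emb, fun a b h => hφ (congrArg Subtype.val h), ?_⟩,
    { S.subtype with commutes' := fun _ => rfl }, Subtype.val_injective⟩
  rintro ⟨d, a, b, hb, rfl⟩
  exact ⟨a, b, hb, Subtype.ext rfl⟩

end RightFractions

namespace MixedWeylAlgebra

variable {k : Type u} [Field k] {m n t : ℕ} {q : Fin n → k}

/-- The inclusion of generators of the Weyl algebra. -/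
def _root_.MWGen.ofWeyl (n t : ℕ) : MWGen m 0 0 → MWGen m n t
  | .x i => .x i
  | .y i => .y i
  | .u i => i.elim0
  | .v i => i.elim0
  | .z i => i.elim0

/-- The Weyl algebra inside the mixed Weyl algebra. -/
noncomputable def ofWeyl (k : Type u) [Field k] (m n t : ℕ) (q : Fin n → k) :
    MixedWeylAlgebra k m 0 0 Fin.elim0 →ₐ[k] MixedWeylAlgebra k m n t q :=
  lift (g := fun a => gen k m n t q (a.ofWeyl n t))
    { weyl := fun i => isMWSystem_gen.weyl i
      quantum := fun i => i.elim0
      comm := fun a b h => isMWSystem_gen.comm _ _ <| by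
        cases a with
        | x i => cases b with
          | x i => exact h
          | y i => exact h
          | u i => exact i.elim0
          | v i => exact i.elim0
          | z i => exact i.elim0
        | y i => cases b with
          | x i => exact h
          | y i => exact h
          | u i => exact i.elim0
          | v i => exact i.elim0
          | z i => exact i.elim0
        | u i => exact i.elim0
        | v i => exact i.elim0
        | z i => exact i.elim0 }

/-- Specialization of the variables not belonging to the Weyl algebra. -/
noncomputable def specialize (c : MWGen m n t → k) :
    MvPolynomial (MWGen m n t) k →ₐ[k] MvPolynomial (MWGen m 0 0) k :=
  aeval fun
    | .x i => X (.x i)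
    | .y i => X (.y i)
    | .u i => C (c (.u i))
    | .v i => C (c (.v i))
    | .z i => C (c (.z i))

theorem specialize_X_x (c : MWGen m n t → k) (i : Fin m) :
    specialize c (X (.x i)) = X (.x i) := by simp [specialize]

theorem specialize_X_y (c : MWGen m n t → k) (i : Fin m) :
    specialize c (X (.y i)) = X (.y i) := by simp [specialize]

theorem specialize_pderiv_y (c : MWGen m n t → k) (i : Fin m) (f : MvPolynomial (MWGen m n t) k) :
    specialize c (pderiv (.y i) f) = pderiv (.y i) (specialize c f) := by
  induction f using MvPolynomial.induction_on with
  | C a => simp [specialize]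
  | add p q hp hq => simp [hp, hq]
  | mul_X p a hp =>
    have : specialize c (pderiv (.y i) (X a)) = pderiv (.y i) (specialize c (X a)) := by
      cases a <;> simp [specialize, pderiv_X, Pi.single_apply, apply_ite]
    simp only [pderiv_mul, map_add, map_mul, hp, this]

theorem specialize_mwAct (c : MWGen m n t → k) (a : MWGen m 0 0)
    (f : MvPolynomial (MWGen m n t) k) :
    specialize c (mwAct q (a.ofWeyl n t) f) = mwAct Fin.elim0 a (specialize c f) := by
  cases a with
  | x i => simp [MWGen.ofWeyl, mwAct_x, specialize_X_x, specialize_pderiv_y]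
  | y i => simp [MWGen.ofWeyl, mwAct_of_isPoly _ (a := .y i) trivial, specialize_X_y]
  | u i => exact i.elim0
  | v i => exact i.elim0
  | z i => exact i.elim0

theorem specialize_act (c : MWGen m n t → k) (a : MixedWeylAlgebra k m 0 0 Fin.elim0)
    (f : MvPolynomial (MWGen m n t) k) :
    specialize c (act k m n t q (ofWeyl k m n t q a) f) =
      act k m 0 0 Fin.elim0 a (specialize c f) := by
  have ha : a ∈ Algebra.adjoin k (Set.range (gen k m 0 0 Fin.elim0)) := by
    rw [adjoin_range_gen]; trivial
  induction ha using Algebra.adjoin_induction generalizing f with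
  | mem a ha =>
    obtain ⟨a, rfl⟩ := ha
    rw [ofWeyl, lift_gen, act_gen, act_gen, specialize_mwAct]
  | algebraMap r => simp
  | add x y _ _ hx hy => simp [hx, hy]
  | mul x y _ _ hx hy => simp [hx, hy]

theorem exists_specialize_ne_zero [Infinite k] {f : MvPolynomial (MWGen m n t) k} (hf : f ≠ 0) :
    ∃ c, specialize c f ≠ 0 := by
  by_contra! h
  refine hf (MvPolynomial.funext fun c => ?_)
  have h1 : (eval fun a : MWGen m 0 0 => c (a.ofWeyl n t)).comp (specialize c).toRingHom =
      eval c := by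
    refine MvPolynomial.ringHom_ext (fun r => by simp [specialize]) fun a => ?_
    cases a <;> simp [specialize, MWGen.ofWeyl]
  rw [← h1]
  simp [h c]

theorem act_apply_one_ne_zero {a : MixedWeylAlgebra k m n t q} (ha : a ≠ 0) :
    act k m n t q a 1 ≠ 0 := fun h => ha (act_apply_one_injective (by simpa using h))

theorem ofWeyl_injective : Function.Injective (ofWeyl k m n t q) := by
  rw [injective_iff_map_eq_zero]
  intro a h
  by_contra ha
  have := specialize_act (t := t) (q := q) 0 a 1
  rw [h] at this
  simp only [map_zero, LinearMap.zero_apply, map_one] at this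
  exact act_apply_one_ne_zero ha this.symm

theorem ore_of_fractionDivisionRing [Infinite k]
    (F : FractionDivisionRing k (MixedWeylAlgebra k m n t q))
    (a b : MixedWeylAlgebra k m 0 0 Fin.elim0) (hb : b ≠ 0) :
    ∃ c e : MixedWeylAlgebra k m 0 0 Fin.elim0, e ≠ 0 ∧ a * e = b * c := by
  have h0 {a} (ha : a ≠ 0) : F.emb a ≠ 0 :=
    fun h => ha (F.emb_injective (h.trans (map_zero F.emb).symm))
  have hb' : F.emb (ofWeyl k m n t q b) ≠ 0 :=
    h0 fun h => hb (ofWeyl_injective (h.trans (map_zero _).symm))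
  obtain ⟨c, e, he, h⟩ := F.frac ((F.emb (ofWeyl k m n t q b))⁻¹ * F.emb (ofWeyl k m n t q a))
  have h1 : ofWeyl k m n t q a * e = ofWeyl k m n t q b * c := by
    apply F.emb_injective
    rw [map_mul, map_mul]
    rw [eq_mul_inv_iff_mul_eq₀ (h0 he), mul_assoc, inv_mul_eq_iff_eq_mul₀ hb'] at h
    exact h
  obtain ⟨s, hs⟩ := exists_specialize_ne_zero (act_apply_one_ne_zero he)
  refine ⟨isMWSystem_gen.ord (specialize s (act k m n t q c 1)),
    isMWSystem_gen.ord (specialize s (act k m n t q e 1)), fun h => hs ?_, ?_⟩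
  · rw [← act_ord_one (q := Fin.elim0) (specialize s _), h]
    simp
  · apply act_apply_one_injective
    simp only [map_mul, Module.End.mul_apply, act_ord_one]
    rw [← specialize_act, ← specialize_act, ← Module.End.mul_apply, ← Module.End.mul_apply,
      ← map_mul, ← map_mul, h1]

theorem exists_weyl_fractionDivisionRing [Infinite k]
    (F : FractionDivisionRing k (MixedWeylAlgebra k m n t q)) :
    ∃ (E : FractionDivisionRing k (WeylAlgebra k m)) (g : E.carrier →ₐ[k] F.carrier),
      Function.Injective g :=
  exists_fractionDivisionRing_of_ore (W := MixedWeylAlgebra k m 0 0 Fin.elim0)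
    (F.emb.comp (ofWeyl k m n t q)) (F.emb_injective.comp ofWeyl_injective)
    (ore_of_fractionDivisionRing F)

end MixedWeylAlgebra

section WeylCharP

variable {K V : Type*} [Field K] [AddCommGroup V] [Module K V]

theorem Submodule.finrank_map_add_finrank_inf_ker [FiniteDimensional K V] (U : Submodule K V)
    (T : Module.End K V) :
    Module.finrank K (U.map T) + Module.finrank K (U ⊓ LinearMap.ker T : Submodule K V) =
      Module.finrank K U := by
  rw [← LinearMap.finrank_range_add_finrank_ker (T.domRestrict U), LinearMap.range_domRestrict,
    LinearMap.ker_domRestrict, ← Submodule.finrank_map_subtype_eq U]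
  rw [Submodule.map_comap_subtype]

theorem weyl_mul_pow {B : Type*} [Ring B] {N Y : B} (h : N * Y = Y * N + 1) (j : ℕ) :
    N * Y ^ (j + 1) = Y ^ (j + 1) * N + (j + 1 : ℕ) • Y ^ j := by
  induction j with
  | zero => simp [h]
  | succ j ih =>
    rw [pow_succ _ (j + 1), ← mul_assoc, ih, add_mul, mul_assoc, h, mul_add, mul_one,
      smul_mul_assoc, ← pow_succ, mul_assoc, add_assoc, add_comm (Y ^ (j + 1)),
      succ_nsmul _ (j + 1)]

theorem weyl_pow_mul {B : Type*} [Ring B] {N Y : B} (h : N * Y = Y * N + 1) (j : ℕ) :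
    N ^ (j + 1) * Y = Y * N ^ (j + 1) + (j + 1 : ℕ) • N ^ j := by
  induction j with
  | zero => simp [h]
  | succ j ih =>
    rw [pow_succ' _ (j + 1), mul_assoc, ih, mul_add, ← mul_assoc, h, add_mul, one_mul,
      mul_smul_comm, ← pow_succ', mul_assoc, add_assoc, add_comm (N ^ (j + 1)),
      succ_nsmul _ (j + 1)]

theorem pow_apply_pow_apply_of_weyl {N Y : Module.End K V} (h : N * Y = Y * N + 1) {w : V}
    (hw : N w = 0) (j : ℕ) : (N ^ j) ((Y ^ j) w) = (j.factorial : K) • w := by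
  induction j with
  | zero => simp
  | succ j ih =>
    have h1 : N ((Y ^ (j + 1)) w) = (j + 1 : ℕ) • (Y ^ j) w := by
      rw [← Module.End.mul_apply, weyl_mul_pow h]
      simp [hw, add_smul]
    rw [pow_succ, Module.End.mul_apply, h1, map_nsmul, ih, Nat.factorial_succ, Nat.cast_mul,
      mul_smul, Nat.cast_smul_eq_nsmul K (j + 1)]

theorem finrank_inf_ker_pow_of_weyl [FiniteDimensional K V] (p : ℕ) [Fact p.Prime] [CharP K p]
    {N Y : Module.End K V} (h : N * Y = Y * N + 1) {U : Submodule K V} (hN : U ≤ U.comap N)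
    (hY : U ≤ U.comap Y) {j : ℕ} (hj : j ≤ p) :
    Module.finrank K (U ⊓ LinearMap.ker (N ^ j) : Submodule K V) =
      j * Module.finrank K (U ⊓ LinearMap.ker N : Submodule K V) := by
  induction j with
  | zero => simp [Module.End.one_eq_id]
  | succ j ih =>
    have hNj : ∀ i : ℕ, ∀ u ∈ U, (N ^ i) u ∈ U := by
      intro i u hu
      induction i with
      | zero => simpa
      | succ i ih =>
        rw [pow_succ', Module.End.mul_apply]
        exact hN ih
    have hYj : ∀ i : ℕ, ∀ u ∈ U, (Y ^ i) u ∈ U := by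
      intro i u hu
      induction i with
      | zero => simpa
      | succ i ih =>
        rw [pow_succ', Module.End.mul_apply]
        exact hY ih
    have h1 : (U ⊓ LinearMap.ker (N ^ (j + 1))).map (N ^ j) = U ⊓ LinearMap.ker N := by
      apply le_antisymm
      · rintro _ ⟨u, ⟨hu, hu'⟩, rfl⟩
        refine ⟨hNj _ u hu, ?_⟩
        rw [SetLike.mem_coe, LinearMap.mem_ker, ← Module.End.mul_apply, ← pow_succ']
        exact hu'
      · rintro w ⟨hw, hw'⟩
        rw [SetLike.mem_coe, LinearMap.mem_ker] at hw'
        have hfac : (j.factorial : K) ≠ 0 := by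
          rw [Ne, CharP.cast_eq_zero_iff K p, Nat.Prime.dvd_factorial Fact.out]
          omega
        refine ⟨(j.factorial : K)⁻¹ • (Y ^ j) w, ⟨U.smul_mem _ (hYj _ w hw), ?_⟩, ?_⟩
        · rw [SetLike.mem_coe, LinearMap.mem_ker, map_smul, pow_succ', Module.End.mul_apply,
            pow_apply_pow_apply_of_weyl h hw', map_smul, hw', smul_zero, smul_zero]
        · rw [map_smul, pow_apply_pow_apply_of_weyl h hw', inv_smul_smul₀ hfac]
    have h2 : U ⊓ LinearMap.ker (N ^ (j + 1)) ⊓ LinearMap.ker (N ^ j) =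
        U ⊓ LinearMap.ker (N ^ j) := by
      rw [inf_assoc, (inf_eq_right (a := LinearMap.ker (N ^ (j + 1)))).mpr]
      intro u hu
      rw [LinearMap.mem_ker] at hu ⊢
      rw [pow_succ', Module.End.mul_apply, hu, map_zero]
    have h3 := (U ⊓ LinearMap.ker (N ^ (j + 1))).finrank_map_add_finrank_inf_ker (N ^ j)
    rw [h1, h2, ih (by omega)] at h3
    rw [← h3]
    ring

theorem pow_card_dvd_finrank_of_weyl [IsAlgClosed K] [FiniteDimensional K V] (p : ℕ)
    [Fact p.Prime] [CharP K p] {ι : Type*} {X Y : ι → Module.End K V}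
    (hXY : ∀ i, X i * Y i = Y i * X i + 1) (hX : ∀ i j, Commute (X i) (X j))
    (hne : ∀ i j, i ≠ j → Commute (X i) (Y j))
    (s : Finset ι) (U : Submodule K V) (hU : ∀ i ∈ s, U ≤ U.comap (X i) ∧ U ≤ U.comap (Y i)) :
    p ^ s.card ∣ Module.finrank K U := by
  classical
  induction s using Finset.induction_on generalizing U with
  | empty => simp
  | insert i s his ihs =>
    induction hd : Module.finrank K U using Nat.strong_induction_on generalizing U with
    | _ d ihd =>
    rcases eq_or_ne U ⊥ with rfl | hbot
    · rw [← hd, finrank_bot]; exact dvd_zero _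
    have hi := hU i (Finset.mem_insert_self _ _)
    have : Nontrivial U := Submodule.nontrivial_iff_ne_bot.mpr hbot
    obtain ⟨μ, hμ⟩ := Module.End.exists_eigenvalue ((X i).restrict hi.1)
    obtain ⟨w, hw⟩ := hμ.exists_hasEigenvector
    set N : Module.End K V := X i - algebraMap K _ μ with hNdef
    have hNw : N w = 0 := by
      have := congrArg Subtype.val hw.apply_eq_smul
      simp only [LinearMap.coe_restrict_apply, Submodule.coe_smul] at this
      rw [hNdef, LinearMap.sub_apply, this, Module.algebraMap_end_apply, sub_self]
    have hNY : N * Y i = Y i * N + 1 := by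
      rw [hNdef, sub_mul, hXY, mul_sub, Algebra.commutes]
      abel
    have hcomm : ∀ {T}, Commute (X i) T → Commute N T := fun hT =>
      hT.sub_left (Algebra.commutes _ _)
    have hpY : Commute (N ^ p) (Y i) := by
      obtain ⟨r, hr⟩ := Nat.exists_eq_succ_of_ne_zero (Fact.out : p.Prime).ne_zero
      have := weyl_pow_mul hNY r
      rw [← Nat.succ_eq_add_one, ← hr, ← Nat.cast_smul_eq_nsmul K, CharP.cast_eq_zero, zero_smul,
        add_zero] at this
      exact this
    have hpX : ∀ j, Commute (N ^ p) (X j) := fun j => (hcomm (hX i j)).pow_left _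
    have hpYall : ∀ j, Commute (N ^ p) (Y j) := fun j => by
      by_cases hij : i = j
      · exact hij ▸ hpY
      · exact (hcomm (hne i j hij)).pow_left _
    have hmap : ∀ {T A : Module.End K V} {U : Submodule K V}, Commute T A → U ≤ U.comap A →
        U.map T ≤ (U.map T).comap A := by
      rintro T A U hTA hUA _ ⟨u, hu, rfl⟩
      refine ⟨A u, hUA hu, ?_⟩
      rw [← Module.End.mul_apply, hTA.eq, Module.End.mul_apply]
    have hker : ∀ {T A : Module.End K V} {U : Submodule K V}, Commute T A → U ≤ U.comap A →
        U ⊓ LinearMap.ker T ≤ (U ⊓ LinearMap.ker T).comap A := by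
      rintro T A U hTA hUA u ⟨hu, hu'⟩
      rw [SetLike.mem_coe, LinearMap.mem_ker] at hu'
      refine ⟨hUA hu, ?_⟩
      rw [SetLike.mem_coe, LinearMap.mem_ker, ← Module.End.mul_apply, hTA.eq,
         Module.End.mul_apply, hu', map_zero]
    have hUN : U ≤ U.comap N := fun u hu => U.sub_mem (hi.1 hu) (by
      rw [Module.algebraMap_end_apply]; exact U.smul_mem _ hu)
    have hsum := U.finrank_map_add_finrank_inf_ker (N ^ p)
    have hrank := finrank_inf_ker_pow_of_weyl p hNY hUN hi.2 le_rfl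
    have hpos : 0 < Module.finrank K (U ⊓ LinearMap.ker N : Submodule K V) := by
      rw [Module.finrank_pos_iff, Submodule.nontrivial_iff_ne_bot, Submodule.ne_bot_iff]
      exact ⟨w, ⟨w.2, hNw⟩, fun h => hw.2 (Subtype.ext h)⟩
    have hppos := (Fact.out : p.Prime).pos
    have h1 : p ^ (insert i s).card ∣ Module.finrank K (U.map (N ^ p)) := by
      refine ihd _ ?_ _ (fun j hj => ⟨hmap (hpX j) (hU j hj).1, hmap (hpYall j) (hU j hj).2⟩) rfl
      have := Nat.mul_pos hppos hpos
      omega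
    have h2 : p ^ s.card ∣ Module.finrank K (U ⊓ LinearMap.ker N : Submodule K V) := by
      refine ihs _ fun j hj => ?_
      have hij : i ≠ j := fun h => his (h ▸ hj)
      have := hU j (Finset.mem_insert_of_mem hj)
      exact ⟨hker (hcomm (hX i j)) this.1, hker (hcomm (hne i j hij)) this.2⟩
    rw [← hd, ← hsum, hrank]
    refine dvd_add h1 ?_
    rw [Finset.card_insert_of_notMem his, pow_succ']
    exact mul_dvd_mul_left _ h2

end WeylCharP

section PowerSubalgebra

variable {σ F : Type*} [Fintype σ] [Field F] (d : σ → ℕ)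

/-- Substituting a power for each variable. -/
noncomputable def MvPolynomial.powSubst (F : Type*) [Field F] (d : σ → ℕ) :
    MvPolynomial σ F →ₐ[F] MvPolynomial σ F :=
  aeval fun a => X a ^ d a

/-- Multiplication of the exponents by `d`. -/
noncomputable def scaleExponent (e : σ →₀ ℕ) : σ →₀ ℕ :=
  Finsupp.equivFunOnFinite.symm fun a => d a * e a

@[simp]
theorem scaleExponent_apply (e : σ →₀ ℕ) (a : σ) : scaleExponent d e a = d a * e a := rfl

theorem MvPolynomial.powSubst_monomial (e : σ →₀ ℕ) (c : F) :
    powSubst F d (monomial e c) = monomial (scaleExponent d e) c := by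
  have h : (monomial (scaleExponent d e) c : MvPolynomial σ F) =
      C c * ∏ a, X a ^ (scaleExponent d e a) := by
    rw [monomial_eq, Finsupp.prod_fintype _ _ (by simp)]
  rw [powSubst, aeval_monomial, Finsupp.prod_fintype _ _ (by simp), h]
  simp [pow_mul, MvPolynomial.algebraMap_eq]

/-- The exponent vector with prescribed small entries. -/
noncomputable def smallExponent {d : σ → ℕ} (r : ∀ a, Fin (d a)) : σ →₀ ℕ :=
  Finsupp.equivFunOnFinite.symm fun a => r a

@[simp]
theorem smallExponent_apply {d : σ → ℕ} (r : ∀ a, Fin (d a)) (a : σ) :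
    smallExponent r a = r a := rfl

theorem scaleExponent_add_smallExponent_inj {d : σ → ℕ} {e e' : σ →₀ ℕ}
    {r r' : ∀ a, Fin (d a)} :
    scaleExponent d e + smallExponent r = scaleExponent d e' + smallExponent r' ↔
      e = e' ∧ r = r' := by
  refine ⟨fun h => ?_, by rintro ⟨rfl, rfl⟩; rfl⟩
  have key : ∀ a, d a * e a + r a = d a * e' a + r' a := fun a => by
    simpa using DFunLike.congr_fun h a
  constructor
  · ext a
    have h1 := congrArg (· / d a) (key a)
    simpa [Nat.mul_add_div (r a).pos, Nat.div_eq_of_lt (r a).2, Nat.div_eq_of_lt (r' a).2] using h1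
  · ext a
    have h1 := congrArg (· % d a) (key a)
    simpa [Nat.mod_eq_of_lt (r a).2, Nat.mod_eq_of_lt (r' a).2] using h1

theorem coeff_powSubst_mul_monomial [DecidableEq (∀ a, Fin (d a))] (b : MvPolynomial σ F)
    (e : σ →₀ ℕ) (r r' : ∀ a, Fin (d a)) :
    coeff (scaleExponent d e + smallExponent r)
      (powSubst F d b * monomial (smallExponent r') 1) = if r = r' then coeff e b else 0 := by
  classical
  induction b using MvPolynomial.induction_on' with
  | monomial e' c =>
    rw [powSubst_monomial, monomial_mul, mul_one, coeff_monomial, coeff_monomial]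
    by_cases h : r = r'
    · subst h
      simp only [scaleExponent_add_smallExponent_inj, and_true, if_true]
    · rw [if_neg, if_neg h]
      exact fun h1 => h (scaleExponent_add_smallExponent_inj.mp h1).2.symm
  | add p q hp hq =>
    rw [map_add, add_mul, coeff_add, hp, hq, coeff_add]
    split_ifs <;> simp

theorem linearIndependent_smallExponent :
    LinearIndependent (powSubst F d).range
      fun r : ∀ a, Fin (d a) => (monomial (smallExponent r) 1 : MvPolynomial σ F) := by
  classical
  rw [Fintype.linearIndependent_iff]
  intro c hc r
  choose b hb using fun r => (c r).2
  have h1 : b r = 0 := by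
    ext e
    have h2 := congrArg (coeff (scaleExponent d e + smallExponent r)) hc
    rw [coeff_sum, coeff_zero, Finset.sum_eq_single r] at h2
    · rw [Subalgebra.smul_def, smul_eq_mul, ← hb] at h2
      have h3 := coeff_powSubst_mul_monomial d (b r) e r r
      rw [if_pos rfl] at h3
      rw [coeff_zero, ← h3]
      exact h2
    · intro r' _ hr
      rw [Subalgebra.smul_def, smul_eq_mul, ← hb]
      have h3 := coeff_powSubst_mul_monomial d (b r') e r r'
      rw [if_neg hr.symm] at h3
      exact h3
    · simp
  exact Subtype.ext (by rw [← hb, h1]; simp)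

theorem span_smallExponent (hd : ∀ a, 0 < d a) :
    ⊤ ≤ Submodule.span (powSubst F d).range
      (Set.range fun r : ∀ a, Fin (d a) => (monomial (smallExponent r) 1 : MvPolynomial σ F)) := by
  intro f _
  rw [f.as_sum]
  refine sum_mem fun e _ => ?_
  let r : ∀ a, Fin (d a) := fun a => ⟨e a % d a, Nat.mod_lt _ (hd a)⟩
  let e' : σ →₀ ℕ := Finsupp.equivFunOnFinite.symm fun a => e a / d a
  have h : scaleExponent d e' + smallExponent r = e := by
    ext a
    simp [e', r, Nat.div_add_mod]
  have h1 : monomial e (coeff e f) =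
      (⟨powSubst F d (monomial e' (coeff e f)), AlgHom.mem_range_self _ _⟩ :
        (powSubst F d).range) • (monomial (smallExponent r) 1 : MvPolynomial σ F) := by
    change _ = powSubst F d (monomial e' (coeff e f)) * monomial (smallExponent r) 1
    rw [powSubst_monomial, monomial_mul, h, mul_one]
  rw [h1]
  exact Submodule.smul_mem _ _ (Submodule.subset_span ⟨r, rfl⟩)

/-- The polynomial ring is free over the ring of polynomials in powers of the variables. -/
noncomputable def powSubstBasis (hd : ∀ a, 0 < d a) :
    Module.Basis (∀ a, Fin (d a)) (powSubst F d).range (MvPolynomial σ F) :=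
  Module.Basis.mk (linearIndependent_smallExponent d) (span_smallExponent d hd)

end PowerSubalgebra

open TensorProduct

/-- The degrees of central powers of the variables. -/
def MWGen.centralExponent {m n t : ℕ} (p l : ℕ) : MWGen m n t → ℕ
  | .x _ => 1
  | .y _ => p
  | .u _ => 1
  | .v _ => l
  | .z _ => 1

theorem MWGen.prod_centralExponent (m n t p l : ℕ) :
    ∏ a : MWGen m n t, a.centralExponent p l = p ^ m * l ^ n := by
  rw [← equivSum.symm.prod_comp]
  simp [Fintype.prod_sum_type, equivSum, centralExponent]

section Reduction

variable {F : Type*} [Field F] {m n t : ℕ} (q : Fin n → F) (p l : ℕ)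

theorem pderiv_powSubst [CharP F p] (i : Fin m) (b : MvPolynomial (MWGen m n t) F) :
    pderiv (.y i) (powSubst F (MWGen.centralExponent p l) b) = 0 := by
  induction b using MvPolynomial.induction_on with
  | C a => simp [powSubst]
  | add p q hp hq => simp [hp, hq]
  | mul_X f a hp =>
    have : pderiv (.y i) (powSubst F (MWGen.centralExponent p l) (X a)) = 0 := by
      rw [powSubst, aeval_X, pderiv_pow]
      cases a <;> simp [MWGen.centralExponent, pderiv_X]
    rw [map_mul, pderiv_mul, hp, this, zero_mul, mul_zero, add_zero]

theorem rescale_powSubst (hq : ∀ i, q i ^ l = 1) (i : Fin n) (b : MvPolynomial (MWGen m n t) F) :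
    rescale (.v i) (q i) (powSubst F (MWGen.centralExponent p l) b) =
      powSubst F (MWGen.centralExponent p l) b := by
  induction b using MvPolynomial.induction_on with
  | C a => simp [powSubst]
  | add p q hp hq => simp [hp, hq]
  | mul_X f a hp =>
    rw [map_mul, map_mul, hp, powSubst, aeval_X, map_pow]
    congr 1
    by_cases ha : a = .v i
    · subst ha
      rw [rescale_X_self, mul_pow, MWGen.centralExponent, ← map_pow, hq, map_one, one_mul]
    · rw [rescale_X_of_ne ha]

variable [CharP F p]

theorem mwAct_powSubst_mul (hq : ∀ i, q i ^ l = 1) (a : MWGen m n t)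
    (b f : MvPolynomial (MWGen m n t) F) :
    mwAct q a (powSubst F (MWGen.centralExponent p l) b * f) =
      powSubst F (MWGen.centralExponent p l) b * mwAct q a f := by
  cases a with
  | x i => rw [mwAct_x, mwAct_x, pderiv_mul, pderiv_powSubst]; ring
  | u i => rw [mwAct_u, mwAct_u, map_mul, rescale_powSubst _ _ _ hq]; ring
  | _ i => exact mul_left_comm _ _ _

/-- The action of the generators, as linear maps over the ring of central powers. -/
noncomputable def mwActCentral (hq : ∀ i, q i ^ l = 1) (a : MWGen m n t) :
    Module.End (powSubst F (MWGen.centralExponent (m := m) (n := n) (t := t) p l)).range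
      (MvPolynomial (MWGen m n t) F) :=
  { mwAct q a with
    map_smul' := by
      rintro ⟨_, b, rfl⟩ f
      exact mwAct_powSubst_mul q p l hq a b f }

theorem isMWSystem_mwActCentral (hq : ∀ i, q i ^ l = 1) :
    IsMWSystem q (mwActCentral (m := m) (t := t) q p l hq) where
  weyl i := LinearMap.ext fun f => LinearMap.congr_fun ((isMWSystem_mwAct q).weyl i) f
  quantum i := LinearMap.ext fun f => LinearMap.congr_fun ((isMWSystem_mwAct q).quantum i) f
  comm a b h := LinearMap.ext fun f => LinearMap.congr_fun ((isMWSystem_mwAct q).comm a b h).eq f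

/-- Restriction of scalars for endomorphisms, as an algebra map. -/
def Module.End.restrictScalarsAlgHom (F C P : Type*) [CommRing F] [CommRing C] [Algebra F C]
    [AddCommGroup P] [Module F P] [Module C P] [IsScalarTower F C P] :
    Module.End C P →ₐ[F] Module.End F P where
  toFun T := T.restrictScalars F
  map_one' := rfl
  map_mul' _ _ := rfl
  map_zero' := rfl
  map_add' _ _ := rfl
  commutes' r := LinearMap.ext fun f => by simp [Module.algebraMap_end_apply]

theorem ord_mwActCentral_apply (hq : ∀ i, q i ^ l = 1) (f g : MvPolynomial (MWGen m n t) F) :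
    (isMWSystem_mwActCentral q p l hq).ord f g = mwOp q f g := by
  have := (isMWSystem_mwActCentral q p l hq).map_ord (Module.End.restrictScalarsAlgHom F _ _) f
  exact LinearMap.congr_fun this g

end Reduction

/-- The commutators of the generators of the Weyl algebra. -/
def weylBracket {r : ℕ} : Fin r ⊕ Fin r → Fin r ⊕ Fin r → ℤ
  | .inl i, .inr j => if i = j then 1 else 0
  | .inr i, .inl j => if i = j then -1 else 0
  | _, _ => 0

/-- The relations expressing, without denominators, that the fractions `w a * s⁻¹`
satisfy the relations of the Weyl algebra. -/
structure IsWeylFraction {B : Type*} [Ring B] {r : ℕ} (w w' : Fin r ⊕ Fin r → B) (s s' : B) :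
    Prop where
  mul_eq : ∀ a, w a * s' = s * w' a
  bracket : ∀ a b, w a * w' b - w b * w' a = weylBracket a b • (s * s')

namespace IsWeylFraction

variable {B B' : Type*} [Ring B] [Ring B'] {r : ℕ} {w w' : Fin r ⊕ Fin r → B} {s s' : B}

theorem map (h : IsWeylFraction w w' s s') (φ : B →+* B') :
    IsWeylFraction (fun a => φ (w a)) (fun a => φ (w' a)) (φ s) (φ s') where
  mul_eq a := by rw [← map_mul, h.mul_eq, map_mul]
  bracket a b := by
    rw [← map_mul, ← map_mul, ← map_sub, h.bracket, map_zsmul, map_mul]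

theorem of_map {φ : B →+* B'} (hφ : Function.Injective φ)
    (h : IsWeylFraction (fun a => φ (w a)) (fun a => φ (w' a)) (φ s) (φ s')) :
    IsWeylFraction w w' s s' where
  mul_eq a := hφ (by rw [map_mul, h.mul_eq, map_mul])
  bracket a b := hφ (by rw [map_sub, map_mul, map_mul, h.bracket, map_zsmul, map_mul])

theorem commutator_eq (h : IsWeylFraction w w' s s') {v v' : B} (hv : v * s = 1) (hv' : s' * v' = 1)
    (hsv : s * v = 1) (a b : Fin r ⊕ Fin r) :
    w a * v * (w b * v) - w b * v * (w a * v) = weylBracket a b • 1 := by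
  have key : ∀ a, v * w a = w' a * v' := fun a => by
    rw [← mul_one (v * w a), ← hv', mul_assoc, ← mul_assoc (w a), h.mul_eq, ← mul_assoc,
      ← mul_assoc, hv, one_mul]
  have key2 : ∀ a b, w a * v * (w b * v) = w a * w' b * (v' * v) := fun a b => by
    rw [mul_assoc, ← mul_assoc v, key]
    simp only [mul_assoc]
  rw [key2, key2, ← sub_mul, h.bracket, smul_mul_assoc, mul_assoc, ← mul_assoc s', hv', one_mul,
    hsv]

/-- Over an algebraically closed field of characteristic `p`. -/
theorem pow_dvd_finrank {K V : Type*} [Field K] [AddCommGroup V] [Module K V] [IsAlgClosed K]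
    [FiniteDimensional K V] (p : ℕ) [Fact p.Prime] [CharP K p]
    {w w' : Fin r ⊕ Fin r → Module.End K V} {s s' : Module.End K V}
    (h : IsWeylFraction w w' s s') (hs : Function.Injective s) (hs' : Function.Injective s') :
    p ^ r ∣ Module.finrank K V := by
  have hunit : ∀ {s : Module.End K V}, Function.Injective s → IsUnit s := fun h =>
    (LinearMap.isUnit_iff_ker_eq_bot _).mpr (LinearMap.ker_eq_bot.mpr h)
  obtain ⟨⟨s, v, hsv, hvs⟩, rfl⟩ := hunit hs
  obtain ⟨⟨s', v', hsv', _⟩, rfl⟩ := hunit hs'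
  have hc := h.commutator_eq hvs hsv' hsv
  have := pow_card_dvd_finrank_of_weyl p (X := fun i => w (.inl i) * v)
    (Y := fun i => w (.inr i) * v) (fun i => ?_) (fun i j => ?_) (fun i j hij => ?_)
    Finset.univ ⊤ (fun _ _ => ⟨le_top, le_top⟩)
  · simpa using this
  · rw [← sub_eq_iff_eq_add', hc]
    simp [weylBracket]
  · refine sub_eq_zero.mp ?_
    rw [hc]
    simp [weylBracket]
  · refine sub_eq_zero.mp ?_
    rw [hc]
    simp [weylBracket, hij]

theorem pow_dvd_finrank_of_isDomain {C P : Type*} [CommRing C] [IsDomain C] [AddCommGroup P]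
    [Module C P] [Module.Free C P] [Module.Finite C P] (p : ℕ) [Fact p.Prime] [CharP C p]
    {w w' : Fin r ⊕ Fin r → Module.End C P} {s s' : Module.End C P}
    (h : IsWeylFraction w w' s s') (hs : Function.Injective s) (hs' : Function.Injective s') :
    p ^ r ∣ Module.finrank C P := by
  let L := FractionRing C
  let K := AlgebraicClosure L
  have : Module.Flat C L := IsLocalization.flat L (nonZeroDivisors C)
  have : Module.Flat C K := Module.Flat.trans C L K
  have : CharP L p := charP_of_injective_algebraMap (IsFractionRing.injective C L) p
  have : CharP K p := charP_of_injective_algebraMap (algebraMap L K).injective p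
  have h2 := (h.map (Module.End.baseChangeHom C K P).toRingHom).pow_dvd_finrank p
    (Module.Flat.lTensor_preserves_injective_linearMap (M := K) _ hs)
    (Module.Flat.lTensor_preserves_injective_linearMap (M := K) _ hs')
  rwa [Module.finrank_baseChange] at h2

theorem le_of_finite {F : Type*} [Field F] [Finite F] {m n t : ℕ} {q : Fin n → F}
    (hq : ∀ i, q i ≠ 0) {w w' : Fin r ⊕ Fin r → MvPolynomial (MWGen m n t) F}
    {s s' : MvPolynomial (MWGen m n t) F} (hs : s ≠ 0) (hs' : s' ≠ 0)
    (h : IsWeylFraction (fun a => mwOp q (w a)) (fun a => mwOp q (w' a)) (mwOp q s) (mwOp q s')) :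
    r ≤ m := by
  classical
  have := Fintype.ofFinite F
  obtain ⟨p, hp⟩ := CharP.exists F
  have hprime : p.Prime := CharP.char_is_prime F p
  have : Fact p.Prime := ⟨hprime⟩
  set l := Fintype.card F - 1 with hl
  have hlpos : 0 < l := by
    have := Fintype.one_lt_card (α := F)
    omega
  have hql : ∀ i, q i ^ l = 1 := fun i => FiniteField.pow_card_sub_one_eq_one _ (hq i)
  have hcop : Nat.Coprime p l := by
    rw [Nat.Prime.coprime_iff_not_dvd hprime]
    intro hdvd
    have h1 : p ∣ Fintype.card F :=
      (CharP.cast_eq_zero_iff F p _).mp (FiniteField.cast_card_eq_zero F)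
    have h2 : Fintype.card F = l + 1 := by
      omega
    rw [h2, Nat.dvd_add_right hdvd] at h1
    exact hprime.one_lt.ne' (Nat.dvd_one.mp h1)
  let C := (powSubst F (MWGen.centralExponent (m := m) (n := n) (t := t) p l)).range
  let P := MvPolynomial (MWGen m n t) F
  have hg := isMWSystem_mwActCentral (m := m) (t := t) q p l hql
  have hpos : ∀ a : MWGen m n t, 0 < a.centralExponent p l := fun a => by
    cases a <;> simp [MWGen.centralExponent, hprime.pos, hlpos]
  let basis := powSubstBasis (F := F) _ hpos
  have : Module.Free C P := Module.Free.of_basis basis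
  have : Module.Finite C P := Module.Finite.of_basis basis
  have : CharP C p := charP_of_injective_ringHom (algebraMap F C).injective p
  have h1 : IsWeylFraction (fun a => hg.ord (w a)) (fun a => hg.ord (w' a)) (hg.ord s)
      (hg.ord s') := by
    refine of_map (φ := (Module.End.restrictScalarsAlgHom F C P).toRingHom)
      (fun T T' hT => LinearMap.ext fun f => LinearMap.congr_fun hT f) ?_
    have h2 : ∀ f, (Module.End.restrictScalarsAlgHom F C P).toRingHom (hg.ord f) = mwOp q f :=
      fun f => LinearMap.ext fun g => ord_mwActCentral_apply q p l hql f g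
    simpa only [h2] using h
  have hinj : ∀ {f}, f ≠ 0 → Function.Injective (hg.ord f) := fun {f} hf => by
    have : ⇑(hg.ord f) = mwOp q f := funext fun g => ord_mwActCentral_apply q p l hql f g
    rw [this]
    exact mwOp_injective hq hf
  have h2 := h1.pow_dvd_finrank_of_isDomain p (hinj hs) (hinj hs')
  rw [Module.finrank_eq_card_basis basis, Fintype.card_pi] at h2
  simp only [Fintype.card_fin, MWGen.prod_centralExponent] at h2
  exact (Nat.pow_dvd_pow_iff_le_right hprime.one_lt).mp
    ((Nat.Coprime.pow _ _ hcop).dvd_of_dvd_mul_right h2)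

end IsWeylFraction

theorem Int.isJacobsonRing : IsJacobsonRing ℤ := by
  refine isJacobsonRing_iff_sInf_maximal.mpr fun {I} hI => ?_
  by_cases h0 : I = ⊥
  · refine ⟨{J | J.IsMaximal}, fun J hJ => Or.inl hJ, ?_⟩
    rw [h0, eq_comm, eq_bot_iff]
    intro a ha
    by_contra ha0
    obtain ⟨p, hpa, hp⟩ := Nat.exists_infinite_primes (a.natAbs + 1)
    have hmem : a ∈ Ideal.span {(p : ℤ)} := Submodule.mem_sInf.mp ha _
      (PrincipalIdealRing.isMaximal_of_irreducible (Nat.prime_iff_prime_int.mp hp).irreducible)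
    have hdvd := Int.natCast_dvd.mp (Ideal.mem_span_singleton.mp hmem)
    exact absurd (Nat.le_of_dvd (Int.natAbs_pos.mpr ha0) hdvd) (by omega)
  · exact ⟨{I}, fun J hJ => Or.inl (hJ ▸ hI.isMaximal h0), by simp⟩

theorem IsField.finite_of_finiteType_int {F : Type*} [CommRing F] [Algebra.FiniteType ℤ F]
    (hF : IsField F) : Finite F := by
  let _ : Field F := hF.toField
  have := Int.isJacobsonRing
  have hfin : Module.Finite ℤ F := finite_of_finite_type_of_isJacobsonRing ℤ F
  obtain ⟨p, hp⟩ := CharP.exists F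
  rcases CharP.char_is_prime_or_zero F p with hprime | rfl
  · have : Fact p.Prime := ⟨hprime⟩
    let _ : Algebra (ZMod p) F := ZMod.algebra F p
    have : Module.Finite (ZMod p) F := Module.Finite.of_restrictScalars_finite ℤ (ZMod p) F
    exact Module.finite_of_finite (ZMod p)
  · have : CharZero F := CharP.charP_to_charZero F
    exact absurd (isField_of_isIntegral_of_isField (FaithfulSMul.algebraMap_injective ℤ F)
      (Field.toIsField F)) Int.not_isField

namespace IsWeylFraction

variable {R S : Type*} [CommRing R] [CommRing S] {m n t r : ℕ} {q : Fin n → R}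
  {w w' : Fin r ⊕ Fin r → MvPolynomial (MWGen m n t) R} {s s' : MvPolynomial (MWGen m n t) R}

theorem mwOp_of_map {φ : R →+* S} (hφ : Function.Injective φ)
    (h : IsWeylFraction (fun a => mwOp (φ ∘ q) (MvPolynomial.map φ (w a)))
      (fun a => mwOp (φ ∘ q) (MvPolynomial.map φ (w' a)))
      (mwOp (φ ∘ q) (MvPolynomial.map φ s)) (mwOp (φ ∘ q) (MvPolynomial.map φ s'))) :
    IsWeylFraction (fun a => mwOp q (w a)) (fun a => mwOp q (w' a)) (mwOp q s) (mwOp q s') where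
  mul_eq a := LinearMap.ext fun f => map_injective φ hφ <| by
    simpa [_root_.map_mwOp] using LinearMap.congr_fun (h.mul_eq a) (MvPolynomial.map φ f)
  bracket a b := LinearMap.ext fun f => map_injective φ hφ <| by
    simpa [_root_.map_mwOp, map_zsmul] using
      LinearMap.congr_fun (h.bracket a b) (MvPolynomial.map φ f)

theorem mwOp_map {φ : R →+* S} (hφ : Function.Surjective φ)
    (h : IsWeylFraction (fun a => mwOp q (w a)) (fun a => mwOp q (w' a)) (mwOp q s) (mwOp q s')) :
    IsWeylFraction (fun a => mwOp (φ ∘ q) (MvPolynomial.map φ (w a)))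
      (fun a => mwOp (φ ∘ q) (MvPolynomial.map φ (w' a)))
      (mwOp (φ ∘ q) (MvPolynomial.map φ s)) (mwOp (φ ∘ q) (MvPolynomial.map φ s')) where
  mul_eq a := LinearMap.ext fun f => by
    obtain ⟨f, rfl⟩ := map_surjective φ hφ f
    simpa [_root_.map_mwOp] using congrArg (MvPolynomial.map φ) (LinearMap.congr_fun (h.mul_eq a) f)
  bracket a b := LinearMap.ext fun f => by
    obtain ⟨f, rfl⟩ := map_surjective φ hφ f
    simpa [_root_.map_mwOp, map_zsmul] using
      congrArg (MvPolynomial.map φ) (LinearMap.congr_fun (h.bracket a b) f)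

theorem le_of_field {k : Type*} [Field k] {q : Fin n → k} (hq : ∀ i, q i ≠ 0)
    {w w' : Fin r ⊕ Fin r → MvPolynomial (MWGen m n t) k} {s s' : MvPolynomial (MWGen m n t) k}
    (hs : s ≠ 0) (hs' : s' ≠ 0)
    (h : IsWeylFraction (fun a => mwOp q (w a)) (fun a => mwOp q (w' a)) (mwOp q s) (mwOp q s')) :
    r ≤ m := by
  classical
  let G : Finset (MvPolynomial (MWGen m n t) k) :=
    insert s (insert s' (Finset.univ.image w ∪ Finset.univ.image w'))
  let T₀ : Finset k := G.biUnion coeffs ∪ Finset.univ.image q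
  let T : Finset k := T₀ ∪ T₀.image (·⁻¹)
  let R := Algebra.adjoin ℤ (T : Set k)
  have hT₀ : ∀ c ∈ T₀, c ∈ R := fun c hc => Algebra.subset_adjoin (by simp [T, hc])
  have hT₀' : ∀ c ∈ T₀, c⁻¹ ∈ R := fun c hc => Algebra.subset_adjoin (by
    rw [Finset.mem_coe]
    exact Finset.mem_union_right _ (Finset.mem_image_of_mem _ hc))
  have : Algebra.FiniteType ℤ R :=
    R.fg_iff_finiteType.mp (Subalgebra.fg_adjoin_finset T)
  obtain ⟨M, hM⟩ := Ideal.exists_maximal R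
  have : @Algebra.FiniteType ℤ (R ⧸ M) _ _ (Ring.toIntAlgebra _) :=
    Algebra.FiniteType.of_surjective (Ideal.Quotient.mk M).toIntAlgHom Ideal.Quotient.mk_surjective
  have : Finite (R ⧸ M) :=
    ((Ideal.Quotient.maximal_ideal_iff_isField_quotient M).mp hM).finite_of_finiteType_int
  let _ : Field (R ⧸ M) := Ideal.Quotient.field M
  let ι : R →+* k := R.subtype
  let π : R →+* R ⧸ M := Ideal.Quotient.mk M
  have hι : Function.Injective ι := Subtype.val_injective
  have hunit : ∀ c : R, (c : k) ≠ 0 → (c : k) ∈ T₀ → π c ≠ 0 := fun c hc hcT h0 => by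
    have h1 : c * ⟨_, hT₀' _ hcT⟩ = 1 := Subtype.ext (mul_inv_cancel₀ hc)
    have h2 := congrArg π h1
    rw [map_mul, h0, zero_mul, map_one] at h2
    exact zero_ne_one h2
  have hlift : ∀ f ∈ G, ∃ f' : MvPolynomial (MWGen m n t) R, MvPolynomial.map ι f' = f := by
    intro f hf
    refine mem_range_map_iff_coeffs_subset.mpr fun c hc => ?_
    exact ⟨⟨c, hT₀ c (Finset.mem_union_left _ (Finset.mem_biUnion.mpr ⟨f, hf, hc⟩))⟩, rfl⟩
  have hne : ∀ f : MvPolynomial (MWGen m n t) R, MvPolynomial.map ι f ∈ G →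
      MvPolynomial.map ι f ≠ 0 → MvPolynomial.map π f ≠ 0 := by
    intro f hf hf0 h0
    obtain ⟨e, he⟩ := ne_zero_iff.mp hf0
    rw [coeff_map] at he
    refine hunit (coeff e f) he (Finset.mem_union_left _ (Finset.mem_biUnion.mpr ⟨_, hf, ?_⟩)) ?_
    · have := coeff_mem_coeffs e (p := MvPolynomial.map ι f) (by rwa [coeff_map])
      rwa [coeff_map] at this
    · rw [← coeff_map, h0, coeff_zero]
  obtain ⟨sR, hsR⟩ := hlift s (by simp [G])
  obtain ⟨sR', hsR'⟩ := hlift s' (by simp [G])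
  choose wR hwR using fun a => hlift (w a) (by simp [G])
  choose wR' hwR' using fun a => hlift (w' a) (by simp [G])
  have hqT : ∀ i, q i ∈ T₀ := fun i => by simp [T₀]
  let qR : Fin n → R := fun i => ⟨q i, hT₀ _ (hqT i)⟩
  have h1 : IsWeylFraction (fun a => mwOp qR (wR a)) (fun a => mwOp qR (wR' a)) (mwOp qR sR)
      (mwOp qR sR') := by
    refine mwOp_of_map hι ?_
    simp only [hwR, hwR', hsR, hsR']
    exact h
  exact le_of_finite (q := π ∘ qR) (fun i => hunit _ (hq i) (hqT i))
    (hne _ (by simp [G, hsR]) (hsR ▸ hs)) (hne _ (by simp [G, hsR']) (hsR' ▸ hs'))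
    (h1.mwOp_map Ideal.Quotient.mk_surjective)

end IsWeylFraction

namespace FractionDivisionRing

variable {k A : Type u} [Field k] [Ring A] [Algebra k A] (F : FractionDivisionRing k A)

theorem emb_ne_zero {a : A} (ha : a ≠ 0) : F.emb a ≠ 0 :=
  fun h => ha (F.emb_injective (h.trans (map_zero F.emb).symm))

theorem exists_common_denominator {ι : Type*} [Finite ι] (d : ι → F.carrier) :
    ∃ (w : ι → A) (s : A), s ≠ 0 ∧ ∀ i, d i * F.emb s = F.emb (w i) := by
  classical
  have := Fintype.ofFinite ι
  suffices h : ∀ I : Finset ι, ∃ s : A, s ≠ 0 ∧ ∀ i ∈ I, ∃ w, d i * F.emb s = F.emb w by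
    obtain ⟨s, hs, h⟩ := h Finset.univ
    choose w hw using fun i => h i (Finset.mem_univ i)
    exact ⟨w, s, hs, hw⟩
  intro I
  induction I using Finset.induction_on with
  | empty =>
    refine ⟨1, fun h => ?_, by simp⟩
    simpa using congrArg F.emb h
  | insert i I _ ih =>
    obtain ⟨s, hs, h⟩ := ih
    obtain ⟨p, e, he, hpe⟩ := F.frac (d i * F.emb s)
    refine ⟨s * e, fun h0 => ?_, fun j hj => ?_⟩
    · refine mul_ne_zero (F.emb_ne_zero hs) (F.emb_ne_zero he) ?_
      rw [← map_mul, h0, map_zero]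
    · rcases Finset.mem_insert.mp hj with rfl | hj
      · exact ⟨p, by rw [map_mul, ← mul_assoc, hpe, inv_mul_cancel_right₀ (F.emb_ne_zero he)]⟩
      · obtain ⟨w, hw⟩ := h j hj
        exact ⟨w * e, by rw [map_mul, ← mul_assoc, hw, map_mul]⟩

theorem exists_isWeylFraction {r : ℕ} (d : Fin r ⊕ Fin r → F.carrier)
    (hd : ∀ a b, d a * d b - d b * d a = weylBracket a b • 1) :
    ∃ (w w' : Fin r ⊕ Fin r → A) (s s' : A), s ≠ 0 ∧ s' ≠ 0 ∧ IsWeylFraction w w' s s' := by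
  obtain ⟨w, s, hs, hw⟩ := F.exists_common_denominator d
  obtain ⟨w', s', hs', hw'⟩ := F.exists_common_denominator fun a => (F.emb s)⁻¹ * F.emb (w a)
  have hs0 := F.emb_ne_zero hs
  have key : ∀ a b, F.emb (w a * w' b) = d a * d b * (F.emb s * F.emb s') := fun a b => by
    rw [map_mul, ← hw', ← hw a, ← hw b]
    simp only [mul_assoc, mul_inv_cancel_left₀ hs0]
  refine ⟨w, w', s, s', hs, hs', fun a => F.emb_injective ?_, fun a b => F.emb_injective ?_⟩
  · rw [map_mul, map_mul, ← hw', mul_assoc, mul_inv_cancel_left₀ hs0]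
  · rw [map_sub, key, key, ← sub_mul, hd, map_zsmul, map_mul, smul_mul_assoc, one_mul]

end FractionDivisionRing

theorem IsMWSystem.commutator_eq {k B : Type*} [CommRing k] [Ring B] [Algebra k B] {r n t : ℕ}
    {q : Fin n → k} {g : MWGen r n t → B} (hg : IsMWSystem q g) (a b : Fin r ⊕ Fin r) :
    Sum.elim (fun i => g (.x i)) (fun i => g (.y i)) a *
        Sum.elim (fun i => g (.x i)) (fun i => g (.y i)) b -
      Sum.elim (fun i => g (.x i)) (fun i => g (.y i)) b *
        Sum.elim (fun i => g (.x i)) (fun i => g (.y i)) a = weylBracket a b • 1 := by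
  have hcomm : ∀ a b, ¬ a.IsSpecialPair b → g a * g b - g b * g a = 0 :=
    fun a b h => sub_eq_zero.mpr (hg.comm a b h)
  rcases a with i | i <;> rcases b with j | j <;>
    simp only [Sum.elim_inl, Sum.elim_inr, weylBracket]
  · simpa using hcomm _ _ (by simp [MWGen.IsSpecialPair])
  · by_cases hij : i = j
    · subst hij
      simp [hg.weyl]
    · simpa [hij] using hcomm (.x i) (.y j) (by simpa [MWGen.IsSpecialPair] using hij)
  · by_cases hij : i = j
    · subst hij
      simp [hg.weyl]
    · simpa [hij] using hcomm (.y i) (.x j) (by simpa [MWGen.IsSpecialPair] using hij)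
  · simpa using hcomm _ _ (by simp [MWGen.IsSpecialPair])

namespace MixedWeylAlgebra

theorem le_of_isWeylFraction {k : Type u} [Field k] {m n t r : ℕ} {q : Fin n → k}
    (hq : ∀ i, q i ≠ 0) {w w' : Fin r ⊕ Fin r → MixedWeylAlgebra k m n t q}
    {s s' : MixedWeylAlgebra k m n t q} (hs : s ≠ 0) (hs' : s' ≠ 0)
    (h : IsWeylFraction w w' s s') : r ≤ m := by
  choose f hf using ord_surjective (k := k) (m := m) (n := n) (t := t) (q := q)
  have hact : ∀ a, act k m n t q a = mwOp q (f a) := fun a => by rw [← act_ord, hf]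
  have hne : ∀ a, a ≠ 0 → f a ≠ 0 := fun a ha h0 => ha (by rw [← hf a, h0, map_zero])
  refine IsWeylFraction.le_of_field hq (hne s hs) (hne s' hs') (w := f ∘ w) (w' := f ∘ w') ?_
  simpa only [Function.comp_apply, RingHom.coe_coe, hact]
    using h.map (act k m n t q : _ →+* Module.End k (MvPolynomial (MWGen m n t) k))

theorem le_of_weyl_fractionDivisionRing {k : Type u} [Field k] {m n t r : ℕ} {q : Fin n → k}
    (hq : ∀ i, q i ≠ 0) (F : FractionDivisionRing k (MixedWeylAlgebra k m n t q))
    (φ : WeylAlgebra k r →ₐ[k] F.carrier) : r ≤ m := by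
  obtain ⟨w, w', s, s', hs, hs', h⟩ := F.exists_isWeylFraction _
    (((isMWSystem_gen (k := k) (m := r) (n := 0) (t := 0) (q := Fin.elim0)).map φ).commutator_eq)
  exact le_of_isWeylFraction hq hs hs' h

end MixedWeylAlgebra

end

/-- The w-lower degree of the mixed Weyl skew field `D_{m,n,t}^{q̄}(k)`
equals `2m`: a division ring of fractions of the Weyl algebra `A_m(k)` embeds into
`D = Frac(A_{m,n,t}^{q̄}(k))`, and whenever a division ring of fractions of `A_{m'}(k)`
embeds into `D` one has `m' ≤ m`. -/
theorem stmt14 {k : Type u} [Field k] [CharZero k] (m n t : ℕ) (q : Fin n → k)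
    (hq : ∀ i, q i ≠ 0 ∧ q i ≠ 1)
    (F : FractionDivisionRing k (MixedWeylAlgebra k m n t q)) :
    (∃ (E : FractionDivisionRing k (WeylAlgebra k m))
        (g : E.carrier →ₐ[k] F.carrier), Function.Injective g) ∧
    (∀ m' : ℕ,
      (∃ (E' : FractionDivisionRing k (WeylAlgebra k m'))
          (g : E'.carrier →ₐ[k] F.carrier), Function.Injective g) → m' ≤ m) :=
  ⟨MixedWeylAlgebra.exists_weyl_fractionDivisionRing F, fun _ ⟨E', g, _⟩ =>
    MixedWeylAlgebra.le_of_weyl_fractionDivisionRing (fun i => (hq i).1) F (g.comp E'.emb)⟩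
end
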